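/- Let k be an algebraically closed field and let C = {q = 0} be a smooth plane quartic over k. The following conditions are equivalent: (1) C has infinitely many inflection lines; (2) q is totally harmonic, i.e. H(q) = 0; (3) the characteristic of k is 3 and there exists M ∈ GL₃(k) with q∘M = x⁴ + y⁴ + z⁴ (C is projectively equivalent to the Fermat quartic). -/

import Mathlib

open MvPolynomial

noncomputable section

/-- The classical invariant `S` of a binary quartic form with coefficients `f 0, …, f 4`. -/
def Sinv {R : Type*} [CommRing R] (f : Fin 5 → R) : R :=
  12 * f 0 * f 4 - 3 * f 1 * f 3 + f 2 ^ 2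

/-- The classical invariant `T` of a binary quartic form with coefficients `f 0, …, f 4`. -/
def Tinv {R : Type*} [CommRing R] (f : Fin 5 → R) : R :=
  72 * f 0 * f 2 * f 4 - 27 * f 0 * f 3 ^ 2 - 27 * f 1 ^ 2 * f 4
    + 9 * f 1 * f 2 * f 3 - 2 * f 2 ^ 3

/-- The binary quartic form `f₀ y⁴ + f₁ y³z + f₂ y²z² + f₃ yz³ + f₄ z⁴`. -/
def binQuartic {R : Type*} [CommRing R] (f : Fin 5 → R) : MvPolynomial (Fin 2) R :=
  ∑ i : Fin 5, C (f i) * X 0 ^ (4 - (i : ℕ)) * X 1 ^ (i : ℕ)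

/-- The `i`-th coefficient of a binary quartic form: coefficient of `y^(4-i) z^i`. -/
def binCoeff {R : Type*} [CommRing R] (g : MvPolynomial (Fin 2) R) (i : Fin 5) : R :=
  coeff (Finsupp.single 0 (4 - (i : ℕ)) + Finsupp.single 1 (i : ℕ)) g

/-- The substitution `g(y,z) = q(-v·y - w·z, u·y, u·z)`, a binary quartic form in `y, z` with
coefficients in `R[u,v,w]`. -/
def gsub {R : Type*} [CommRing R] (q : MvPolynomial (Fin 3) R) :
    MvPolynomial (Fin 2) (MvPolynomial (Fin 3) R) :=
  aeval
    (![(C (- X 1) * X 0 - C (X 2) * X 1 : MvPolynomial (Fin 2) (MvPolynomial (Fin 3) R)),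
       C (X 0) * X 0, C (X 0) * X 1]) q

/-- `u⁴ · H(q)`, the invariant `S` of `g(y,z) = q(-vy-wz, uy, uz)`; the harmonic quartic `H(q)`
is the form determined by `u⁴ · H(q) = SG q`. -/
def SG {R : Type*} [CommRing R] (q : MvPolynomial (Fin 3) R) : MvPolynomial (Fin 3) R :=
  Sinv (fun i => binCoeff (gsub q) i)

/-- `u⁶ · K(q)`, the invariant `T` of `g(y,z) = q(-vy-wz, uy, uz)`; the harmonic sextic `K(q)`
is the form determined by `u⁶ · K(q) = TG q`. -/
def TG {R : Type*} [CommRing R] (q : MvPolynomial (Fin 3) R) : MvPolynomial (Fin 3) R :=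
  Tinv (fun i => binCoeff (gsub q) i)

/-- dot product of two vectors in `R³`. -/
def dot3 {R : Type*} [CommRing R] (d a : Fin 3 → R) : R :=
  d 0 * a 0 + d 1 * a 1 + d 2 * a 2

/-- restriction of a ternary form to the parameterized line `(y,z) ↦ y·a + z·b`. -/
def restrictLine {R : Type*} [CommRing R] (q : MvPolynomial (Fin 3) R) (a b : Fin 3 → R) :
    MvPolynomial (Fin 2) R :=
  aeval (fun i => C (a i) * X 0 + C (b i) * X 1) q

/-- A binary quartic form vanishes identically or has a root of multiplicity at least `3`:
`f = L³·M` with `L ≠ 0` linear and `M` linear (possibly zero). -/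
def HasTripleRoot {R : Type*} [CommRing R] (f : MvPolynomial (Fin 2) R) : Prop :=
  ∃ L M : MvPolynomial (Fin 2) R,
    L.IsHomogeneous 1 ∧ M.IsHomogeneous 1 ∧ L ≠ 0 ∧ f = L ^ 3 * M

/-- The line with dual coordinates `d` is an inflection line of the quartic `{q = 0}`. -/
def IsInflectionLine {k : Type*} [Field k] (q : MvPolynomial (Fin 3) k) (d : Fin 3 → k) :
    Prop :=
  d ≠ 0 ∧ ∃ a b : Fin 3 → k, LinearIndependent k ![a, b] ∧
    dot3 d a = 0 ∧ dot3 d b = 0 ∧ HasTripleRoot (restrictLine q a b)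

/-- The line with dual coordinates `d` is a simple inflection line of `{q = 0}` with
inflection point `p`. -/
def IsSimpleInflectionLineAt {k : Type*} [Field k] (q : MvPolynomial (Fin 3) k)
    (d p : Fin 3 → k) : Prop :=
  d ≠ 0 ∧ ∃ (a b : Fin 3 → k) (s t : k), LinearIndependent k ![a, b] ∧
    dot3 d a = 0 ∧ dot3 d b = 0 ∧ (s, t) ≠ (0, 0) ∧
    (∀ i, p i = s * a i + t * b i) ∧
    eval p q = 0 ∧ (∃ i, eval p (pderiv i q) ≠ 0) ∧
    ∃ L M : MvPolynomial (Fin 2) k, L.IsHomogeneous 1 ∧ M.IsHomogeneous 1 ∧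
      LinearIndependent k ![L, M] ∧
      restrictLine q a b = L ^ 3 * M ∧ eval ![s, t] L = 0

/-- The line with dual coordinates `d` is a hyperinflection line of `{q = 0}` with
hyperinflection point `p`. -/
def IsHyperinflectionLineAt {k : Type*} [Field k] (q : MvPolynomial (Fin 3) k)
    (d p : Fin 3 → k) : Prop :=
  d ≠ 0 ∧ ∃ (a b : Fin 3 → k) (s t : k), LinearIndependent k ![a, b] ∧
    dot3 d a = 0 ∧ dot3 d b = 0 ∧ (s, t) ≠ (0, 0) ∧
    (∀ i, p i = s * a i + t * b i) ∧
    eval p q = 0 ∧ (∃ i, eval p (pderiv i q) ≠ 0) ∧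
    ∃ (c : k) (L : MvPolynomial (Fin 2) k), c ≠ 0 ∧ L.IsHomogeneous 1 ∧ L ≠ 0 ∧
      restrictLine q a b = C c * L ^ 4 ∧ eval ![s, t] L = 0

/-- The pairing `⟨·,·⟩` between quartic forms in `x,y,z` and quartic forms in `u,v,w`:
`⟨x^i y^j z^k, u^i v^j w^k⟩ = i!j!k!/2`. -/
def pairQ {R : Type*} [CommRing R] (q h : MvPolynomial (Fin 3) R) : R :=
  ∑ m ∈ q.support,
    (((m 0).factorial * (m 1).factorial * (m 2).factorial / 2 : ℕ) : R)
      * coeff m q * coeff m h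

/-- The action of `Σ c_{ξη} ξ ∂_η ∈ 𝔤𝔩₃(R)` on polynomials. -/
def lieAct {R : Type*} [CommRing R] (c : Fin 3 → Fin 3 → R)
    (q : MvPolynomial (Fin 3) R) : MvPolynomial (Fin 3) R :=
  ∑ ξ : Fin 3, ∑ η : Fin 3, C (c ξ η) * (X ξ * pderiv η q)

/-- substitution of variables by the linear change of coordinates `M`: `q(M·(x,y,z)ᵗ)`. -/
def substM {R : Type*} [CommRing R] (M : Matrix (Fin 3) (Fin 3) R)
    (q : MvPolynomial (Fin 3) R) : MvPolynomial (Fin 3) R :=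
  aeval (fun i => ∑ j : Fin 3, C (M i j) * X j) q

/-- The quartic form `q_ε = (x−y)⁴ + (x−z)⁴ + (y−εz)⁴ − (x⁴ + y⁴ + z⁴)`. -/
def qeps {k : Type*} [CommRing k] (ε : k) : MvPolynomial (Fin 3) k :=
  (X 0 - X 1) ^ 4 + (X 0 - X 2) ^ 4 + (X 1 - C ε * X 2) ^ 4
    - (X 0 ^ 4 + X 1 ^ 4 + X 2 ^ 4)

lemma ev0_prime {k : Type*} [Field k] (f : MvPolynomial (Fin 3) k →ₐ[k] MvPolynomial (Fin 3) k) :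
    (RingHom.ker f.toRingHom).IsPrime := RingHom.ker_isPrime _

lemma bezout_aux {k : Type*} [Field k] [IsAlgClosed k] (g h : MvPolynomial (Fin 3) k)
    (hg : eval 0 g = 0) (hh : eval 0 h = 0) : ∃ p : Fin 3 → k, p ≠ 0 ∧ eval p g = 0 ∧ eval p h = 0 := by
  by_contra! hcon
  let ψ1 : MvPolynomial (Fin 3) k →ₐ[k] MvPolynomial (Fin 3) k := aeval ![0, X 1, X 2]
  let ψ2 : MvPolynomial (Fin 3) k →ₐ[k] MvPolynomial (Fin 3) k := aeval ![0, 0, X 2]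
  let I1 := RingHom.ker ψ1.toRingHom
  let I2 := RingHom.ker ψ2.toRingHom
  let m : Ideal (MvPolynomial (Fin 3) k) := vanishingIdeal k {(0 : Fin 3 → k)}
  have : I1.IsPrime := ev0_prime ψ1
  have : I2.IsPrime := ev0_prime ψ2
  have : (⊥ : Ideal (MvPolynomial (Fin 3) k)).IsPrime := Ideal.isPrime_bot
  have hm : ∀ f, f ∈ m ↔ eval 0 f = 0 := by
    intro f
    rw [mem_vanishingIdeal_singleton_iff, aeval_eq_eval]
  have h01 : (⊥ : Ideal (MvPolynomial (Fin 3) k)) < I1 := by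
    rw [bot_lt_iff_ne_bot]
    intro hb
    have : (X 0 : MvPolynomial (Fin 3) k) ∈ I1 := by
      simp [I1, ψ1, RingHom.mem_ker]
    rw [hb] at this
    exact X_ne_zero (R := k) (0 : Fin 3) this
  have h12 : I1 < I2 := by
    refine lt_of_le_of_ne ?_ ?_
    · intro f hf
      have e : ψ2 = ψ2.comp ψ1 := by
        apply MvPolynomial.algHom_ext
        intro i
        fin_cases i <;> simp [ψ1, ψ2]
      have hf' : ψ1 f = 0 := hf
      change ψ2 f = 0
      rw [e, AlgHom.comp_apply, hf', map_zero]
    · intro he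
      have h2 : (X 1 : MvPolynomial (Fin 3) k) ∈ I2 := by
        change ψ2 (X 1) = 0
        simp [ψ2]
      rw [← he] at h2
      have h3 : ψ1 (X 1) = 0 := h2
      simp [ψ1] at h3
  have h23 : I2 < m := by
    refine lt_of_le_of_ne ?_ ?_
    · intro f hf
      have hf' : ψ2 f = 0 := hf
      rw [hm]
      have e : (aeval (0 : Fin 3 → k) : MvPolynomial (Fin 3) k →ₐ[k] k) = (aeval (0 : Fin 3 → k)).comp ψ2 := by
        apply MvPolynomial.algHom_ext
        intro i
        fin_cases i <;> simp [ψ2]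
      have := congrArg (fun φ => φ f) e
      simp only [AlgHom.comp_apply, hf', map_zero] at this
      rw [aeval_eq_eval] at this
      exact this
    · intro he
      have h2 : (X 2 : MvPolynomial (Fin 3) k) ∈ m := by
        rw [hm]; simp
      rw [← he] at h2
      have h3 : ψ2 (X 2) = 0 := h2
      simp [ψ2] at h3
  have hm3 : (3 : ℕ∞) ≤ m.height := by
    have a := Ideal.height_add_one_le_of_lt_of_isPrime h01
    have b := Ideal.height_add_one_le_of_lt_of_isPrime h12
    have c := Ideal.height_add_one_le_of_lt_of_isPrime h23
    calc (3 : ℕ∞) ≤ (⊥ : Ideal (MvPolynomial (Fin 3) k)).height + 1 + 1 + 1 := by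
          rw [add_assoc, add_assoc]; exact le_add_self.trans' (by norm_num)
      _ ≤ I1.height + 1 + 1 := by gcongr
      _ ≤ I2.height + 1 := by gcongr
      _ ≤ _ := c
  have hrad : (Ideal.span {g, h}).radical = m := by
    rw [← vanishingIdeal_zeroLocus_eq_radical (K := k)]
    congr 1
    rw [zeroLocus_span]
    ext x
    simp only [Set.mem_insert_iff, Set.mem_singleton_iff, forall_eq_or_imp, forall_eq, Set.mem_ofPred_eq, aeval_eq_eval]
    constructor
    · rintro ⟨a, b⟩
      by_contra hx
      exact hcon x hx a b
    · rintro rfl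
      exact ⟨hg, hh⟩
  have hmin : m ∈ (Ideal.span {g, h}).minimalPrimes := by
    rw [← Ideal.radical_minimalPrimes, hrad, Ideal.minimalPrimes_eq_subsingleton_self]
    rfl
  have hle := Ideal.height_le_card_of_mem_minimalPrimes_span (Set.toFinite _) hmin
  have h2 : ({g, h} : Set (MvPolynomial (Fin 3) k)).ncard ≤ 2 :=
    (Set.ncard_insert_le _ _).trans (by rw [Set.ncard_singleton])
  have : (3 : ℕ∞) ≤ 2 := hm3.trans (hle.trans (by exact_mod_cast h2))
  exact absurd this (by decide)

lemma exists_zero_of_not_isUnit {k : Type*} [Field k] [IsAlgClosed k] (a : MvPolynomial (Fin 3) k)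
    (ha : ¬ IsUnit a) : ∃ p, eval p a = 0 := by
  obtain ⟨M, hM, haM⟩ := exists_max_ideal_of_mem_nonunits ha
  obtain ⟨x, rfl⟩ := eq_vanishingIdeal_singleton_of_isMaximal k hM
  refine ⟨x, ?_⟩
  rw [mem_vanishingIdeal_singleton_iff, aeval_eq_eval] at haM
  exact haM

/-- polynomial in one variable along the ray through `p` -/
def ray {k : Type*} [Field k] (p : Fin 3 → k) : MvPolynomial (Fin 3) k →ₐ[k] Polynomial k :=
  aeval (fun i => Polynomial.C (p i) * Polynomial.X)

lemma ray_eval {k : Type*} [Field k] (p : Fin 3 → k) (f : MvPolynomial (Fin 3) k) (t : k) :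
    (ray p f).eval t = eval (t • p) f := by
  induction f using MvPolynomial.induction_on with
  | C a => simp [ray]
  | add f g hf hg => simp [hf, hg]
  | mul_X f i hf =>
    rw [map_mul, Polynomial.eval_mul, hf, map_mul]
    simp only [ray, aeval_X, Polynomial.eval_mul, Polynomial.eval_C, Polynomial.eval_X, eval_X,
      Pi.smul_apply, smul_eq_mul]
    ring

lemma homog_ray {k : Type*} [Field k] (p : Fin 3 → k) (q : MvPolynomial (Fin 3) k) {n : ℕ}
    (hq : q.IsHomogeneous n) (t : k) : eval (t • p) q = t ^ n * eval p q := by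
  rw [eval_eq', eval_eq', Finset.mul_sum]
  refine Finset.sum_congr rfl fun d hd => ?_
  have h := hq (mem_support_iff.mp hd)
  rw [Finsupp.weight_apply, Finsupp.sum_fintype _ _ (by simp)] at h
  simp only [Pi.one_apply, smul_eq_mul, mul_one] at h
  simp only [Pi.smul_apply, smul_eq_mul, mul_pow, Finset.prod_mul_distrib, Finset.prod_pow_eq_pow_sum, h]
  ring

lemma ray_zero_iff {k : Type*} [Field k] [Infinite k] (p : Fin 3 → k) (f : MvPolynomial (Fin 3) k) :
    ray p f = 0 ↔ ∀ t : k, eval (t • p) f = 0 := by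
  constructor
  · intro h t
    rw [← ray_eval, h, Polynomial.eval_zero]
  · intro h
    apply Polynomial.funext
    intro t
    rw [ray_eval, h, Polynomial.eval_zero]

lemma smooth_prime {k : Type*} [Field k] [IsAlgClosed k]
    (q : MvPolynomial (Fin 3) k) (hq0 : q ≠ 0) (hq4 : q.IsHomogeneous 4)
    (hsm : ∀ pt : Fin 3 → k, pt ≠ 0 → eval pt q = 0 → ∃ i, eval pt (pderiv i q) ≠ 0) :
    Prime q := by
  have key : ∀ a b, q = a * b → ∀ p : Fin 3 → k, p ≠ 0 → eval p a = 0 → eval p b = 0 → False := by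
    intro a b hab p hp ha hb
    obtain ⟨i, hi⟩ := hsm p hp (by rw [hab, map_mul, ha, zero_mul])
    apply hi
    rw [hab, Derivation.leibniz]
    simp [ha, hb]
  have q0 : eval 0 q = 0 := by
    have := homog_ray 0 q hq4 (0 : k)
    simpa using this
  have key2 : ∀ a b, q = a * b → ¬ IsUnit a → eval 0 a ≠ 0 → False := by
    intro a b hab ha ha0
    obtain ⟨p, hp⟩ := exists_zero_of_not_isUnit a ha
    have hp0 : p ≠ 0 := by rintro rfl; exact ha0 hp
    have hr : ray p a * ray p b = 0 := by
      rw [← map_mul, ← hab, ray_zero_iff]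
      intro t
      rw [homog_ray p q hq4, hab, map_mul, hp]; simp
    rcases mul_eq_zero.mp hr with h | h
    · rw [ray_zero_iff] at h
      apply ha0
      simpa using h 0
    · rw [ray_zero_iff] at h
      exact key a b hab p hp0 hp (by simpa using h 1)
  apply Irreducible.prime
  refine ⟨?_, ?_⟩
  · intro hu
    have := hu.map (eval (0 : Fin 3 → k))
    rw [q0] at this
    simp at this
  · intro a b hab
    by_contra! hcon
    by_cases ha : eval 0 a = 0
    · by_cases hb : eval 0 b = 0
      · obtain ⟨p, hp, h1, h2⟩ := bezout_aux a b ha hb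
        exact key a b hab p hp h1 h2
      · exact key2 b a (by rw [hab, mul_comm]) hcon.2 hb
    · exact key2 a b hab hcon.1 ha

lemma nullst {k : Type*} [Field k] [IsAlgClosed k]
    (q : MvPolynomial (Fin 3) k) (hq : Prime q) (P : MvPolynomial (Fin 3) k)
    (h : ∀ p, eval p q = 0 → eval p P = 0) : q ∣ P := by
  have hp : (Ideal.span {q}).IsPrime := (Ideal.span_singleton_prime hq.ne_zero).mpr hq
  rw [← Ideal.mem_span_singleton, ← IsPrime.vanishingIdeal_zeroLocus (K := k) (Ideal.span {q}),
    mem_vanishingIdeal_iff]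
  intro x hx
  rw [zeroLocus_span] at hx
  simp only [Set.mem_singleton_iff, forall_eq, Set.mem_ofPred_eq, aeval_eq_eval] at hx
  rw [aeval_eq_eval]
  exact h x hx

lemma finite_inter {k : Type*} [Field k] [IsAlgClosed k]
    (q : MvPolynomial (Fin 3) k) (hq : Prime q) (P : MvPolynomial (Fin 3) k) {n : ℕ}
    (hqh : q.IsHomogeneous n) (hPh : ∀ (p : Fin 3 → k) (t : k), eval p P = 0 → eval (t • p) P = 0) (hdvd : ¬ q ∣ P) :
    {ℓ : Projectivization k (Fin 3 → k) | eval ℓ.rep q = 0 ∧ eval ℓ.rep P = 0}.Finite := by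
  let I : Projectivization k (Fin 3 → k) → Ideal (MvPolynomial (Fin 3) k) :=
    fun ℓ => RingHom.ker (ray ℓ.rep).toRingHom
  have hI : ∀ ℓ f, f ∈ I ℓ ↔ ∀ t : k, eval (t • ℓ.rep) f = 0 := by
    intro ℓ f
    rw [← ray_zero_iff]; rfl
  have hprime : ∀ ℓ, (I ℓ).IsPrime := fun ℓ => RingHom.ker_isPrime _
  have hinj : Function.Injective I := by
    intro ℓ ℓ' h
    have key : ∀ i j : Fin 3, ℓ'.rep i * ℓ.rep j = ℓ'.rep j * ℓ.rep i := by
      intro i j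
      have h1 : (X i * C (ℓ.rep j) - X j * C (ℓ.rep i) : MvPolynomial (Fin 3) k) ∈ I ℓ := by
        rw [hI]; intro t; simp; ring
      rw [h, hI] at h1
      have := h1 1
      simp at this
      linear_combination this
    rw [← ℓ.mk_rep, ← ℓ'.mk_rep, Projectivization.mk_eq_mk_iff']
    obtain ⟨j, hj⟩ := Function.ne_iff.mp ℓ'.rep_nonzero
    refine ⟨ℓ.rep j / ℓ'.rep j, ?_⟩
    ext i
    have hj' : ℓ'.rep j ≠ 0 := hj
    simp only [Pi.smul_apply, smul_eq_mul]
    field_simp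
    linear_combination key i j
  refine Set.Finite.of_finite_image ?_ hinj.injOn
  refine (Ideal.finite_minimalPrimes_of_isNoetherianRing _ (Ideal.span {q, P})).subset ?_
  rintro _ ⟨ℓ, ⟨h1, h2⟩, rfl⟩
  have := hprime ℓ
  have hle : Ideal.span {q, P} ≤ I ℓ := by
    rw [Ideal.span_le]
    rintro f hf
    rcases hf with rfl | hf
    · change f ∈ I ℓ
      rw [hI]; intro t; rw [homog_ray _ _ hqh, h1, mul_zero]
    · rw [Set.mem_singleton_iff] at hf
      subst hf
      change f ∈ I ℓ
      rw [hI]; intro t; exact hPh _ t h2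
  obtain ⟨Q, hQ, hQle⟩ := Ideal.exists_minimalPrimes_le hle
  have : Q.IsPrime := hQ.1.1
  rcases eq_or_lt_of_le hQle with h | hlt
  · change I ℓ ∈ _
    rw [← h]; exact hQ
  exfalso
  have hqp : (Ideal.span {q}).IsPrime := (Ideal.span_singleton_prime hq.ne_zero).mpr hq
  have : (⊥ : Ideal (MvPolynomial (Fin 3) k)).IsPrime := Ideal.isPrime_bot
  have e1 : (⊥ : Ideal (MvPolynomial (Fin 3) k)) < Ideal.span {q} := by
    rw [bot_lt_iff_ne_bot]
    simp [Ideal.span_singleton_eq_bot, hq.ne_zero]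
  have e2 : Ideal.span {q} < Q := by
    refine lt_of_le_of_ne ?_ ?_
    · exact le_trans (Ideal.span_mono (by simp)) hQ.1.2
    · intro he
      apply hdvd
      rw [← Ideal.mem_span_singleton, he]
      exact hQ.1.2 (Ideal.subset_span (by simp))
  let m : Ideal (MvPolynomial (Fin 3) k) := vanishingIdeal k {(0 : Fin 3 → k)}
  have hm : ∀ f, f ∈ m ↔ eval 0 f = 0 := by
    intro f
    rw [mem_vanishingIdeal_singleton_iff, aeval_eq_eval]
  have e4 : I ℓ < m := by
    refine lt_of_le_of_ne ?_ ?_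
    · intro f hf
      rw [hI] at hf
      rw [hm]
      simpa using hf 0
    · intro he
      apply ℓ.rep_nonzero
      ext i
      have : X i ∈ m := by rw [hm]; simp
      rw [← he, hI] at this
      simpa using this 1
  have a := Ideal.height_add_one_le_of_lt_of_isPrime e1
  have b := Ideal.height_add_one_le_of_lt_of_isPrime e2
  have c := Ideal.height_add_one_le_of_lt_of_isPrime hlt
  have d := Ideal.height_add_one_le_of_lt_of_isPrime e4
  have hm4 : (4 : ℕ∞) ≤ m.height := by
    calc (4 : ℕ∞) ≤ (⊥ : Ideal (MvPolynomial (Fin 3) k)).height + 1 + 1 + 1 + 1 := by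
          rw [add_assoc, add_assoc, add_assoc]; exact le_add_self.trans' (by norm_num)
      _ ≤ (Ideal.span {q}).height + 1 + 1 + 1 := by gcongr
      _ ≤ Q.height + 1 + 1 := by gcongr
      _ ≤ (I ℓ).height + 1 := by gcongr
      _ ≤ _ := d
  have hdim : ringKrullDim (MvPolynomial (Fin 3) k) = 3 := by
    rw [MvPolynomial.ringKrullDim_of_isNoetherianRing, ringKrullDim_eq_zero_of_field]
    simp
  have hmd : (m.height : WithBot ℕ∞) ≤ ringKrullDim (MvPolynomial (Fin 3) k) :=
    Ideal.height_le_ringKrullDim_of_ne_top (Ideal.IsPrime.ne_top inferInstance)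
  rw [hdim] at hmd
  have h5 : ((4 : ℕ∞) : WithBot ℕ∞) ≤ 3 := le_trans (WithBot.coe_le_coe.mpr hm4) hmd
  have h6 : (4 : ℕ∞) ≤ 3 := WithBot.coe_le_coe.mp h5
  exact absurd h6 (by decide)

section forms
variable {R : Type*} [CommRing R]

/-- the ternary quartic with coefficients `c` -/
def qf (c : Fin 15 → R) (x y z : R) : R :=
  c 0 * x ^ 4 + c 1 * x ^ 3 * y + c 2 * x ^ 3 * z + c 3 * x ^ 2 * y ^ 2 + c 4 * x ^ 2 * y * z
    + c 5 * x ^ 2 * z ^ 2 + c 6 * x * y ^ 3 + c 7 * x * y ^ 2 * z + c 8 * x * y * z ^ 2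
    + c 9 * x * z ^ 3 + c 10 * y ^ 4 + c 11 * y ^ 3 * z + c 12 * y ^ 2 * z ^ 2
    + c 13 * y * z ^ 3 + c 14 * z ^ 4

/-- first derivative in `x` -/
def qX (c : Fin 15 → R) (x y z : R) : R :=
  4 * c 0 * x ^ 3 + 3 * c 1 * x ^ 2 * y + 3 * c 2 * x ^ 2 * z + 2 * c 3 * x * y ^ 2
    + 2 * c 4 * x * y * z + 2 * c 5 * x * z ^ 2 + c 6 * y ^ 3 + c 7 * y ^ 2 * z + c 8 * y * z ^ 2
    + c 9 * z ^ 3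

/-- first derivative in `y` -/
def qY (c : Fin 15 → R) (x y z : R) : R :=
  c 1 * x ^ 3 + 2 * c 3 * x ^ 2 * y + c 4 * x ^ 2 * z + 3 * c 6 * x * y ^ 2 + 2 * c 7 * x * y * z
    + c 8 * x * z ^ 2 + 4 * c 10 * y ^ 3 + 3 * c 11 * y ^ 2 * z + 2 * c 12 * y * z ^ 2 + c 13 * z ^ 3

/-- first derivative in `z` -/
def qZ (c : Fin 15 → R) (x y z : R) : R :=
  c 2 * x ^ 3 + c 4 * x ^ 2 * y + 2 * c 5 * x ^ 2 * z + c 7 * x * y ^ 2 + 2 * c 8 * x * y * z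
    + 3 * c 9 * x * z ^ 2 + c 11 * y ^ 3 + 2 * c 12 * y ^ 2 * z + 3 * c 13 * y * z ^ 2
    + 4 * c 14 * z ^ 3

/-- divided second derivative -/
def hXX (c : Fin 15 → R) (x y z : R) : R :=
  6 * c 0 * x ^ 2 + 3 * c 1 * x * y + 3 * c 2 * x * z + c 3 * y ^ 2 + c 4 * y * z + c 5 * z ^ 2

/-- divided second derivative -/
def hYY (c : Fin 15 → R) (x y z : R) : R :=
  c 3 * x ^ 2 + 3 * c 6 * x * y + c 7 * x * z + 6 * c 10 * y ^ 2 + 3 * c 11 * y * z + c 12 * z ^ 2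

/-- divided second derivative -/
def hZZ (c : Fin 15 → R) (x y z : R) : R :=
  c 5 * x ^ 2 + c 8 * x * y + 3 * c 9 * x * z + c 12 * y ^ 2 + 3 * c 13 * y * z + 6 * c 14 * z ^ 2

/-- mixed second derivative -/
def qXY (c : Fin 15 → R) (x y z : R) : R :=
  3 * c 1 * x ^ 2 + 4 * c 3 * x * y + 2 * c 4 * x * z + 3 * c 6 * y ^ 2 + 2 * c 7 * y * z + c 8 * z ^ 2

/-- mixed second derivative -/
def qXZ (c : Fin 15 → R) (x y z : R) : R :=
  3 * c 2 * x ^ 2 + 2 * c 4 * x * y + 4 * c 5 * x * z + c 7 * y ^ 2 + 2 * c 8 * y * z + 3 * c 9 * z ^ 2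

/-- mixed second derivative -/
def qYZ (c : Fin 15 → R) (x y z : R) : R :=
  c 4 * x ^ 2 + 2 * c 7 * x * y + 2 * c 8 * x * z + 3 * c 11 * y ^ 2 + 4 * c 12 * y * z + 3 * c 13 * z ^ 2

/-- divided third derivative -/
def hXXX (c : Fin 15 → R) (x y z : R) : R := 4 * c 0 * x + c 1 * y + c 2 * z
/-- divided third derivative -/
def hXXY (c : Fin 15 → R) (x y z : R) : R := 3 * c 1 * x + 2 * c 3 * y + c 4 * z
/-- divided third derivative -/
def hXYY (c : Fin 15 → R) (x y z : R) : R := 2 * c 3 * x + 3 * c 6 * y + c 7 * z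
/-- divided third derivative -/
def hYYY (c : Fin 15 → R) (x y z : R) : R := c 6 * x + 4 * c 10 * y + c 11 * z

/-- second order Taylor term -/
def Wf (c : Fin 15 → R) (x y z u v w : R) : R :=
  hXX c x y z * u ^ 2 + hYY c x y z * v ^ 2 + hZZ c x y z * w ^ 2 + qXY c x y z * u * v
    + qXZ c x y z * u * w + qYZ c x y z * v * w

/-- first order Taylor term -/
def gdot (c : Fin 15 → R) (x y z u v w : R) : R :=
  qX c x y z * u + qY c x y z * v + qZ c x y z * w

/-- second order term along the tangent vector -/
def Q2 (c : Fin 15 → R) (x y z : R) : R :=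
  hXX c x y z * qY c x y z ^ 2 - qXY c x y z * qX c x y z * qY c x y z
    + hYY c x y z * qX c x y z ^ 2

/-- third order term along the tangent vector -/
def Q3 (c : Fin 15 → R) (x y z : R) : R :=
  hXXX c x y z * qY c x y z ^ 3 - hXXY c x y z * qY c x y z ^ 2 * qX c x y z
    + hXYY c x y z * qY c x y z * qX c x y z ^ 2 - hYYY c x y z * qX c x y z ^ 3

lemma taylor (c : Fin 15 → R) (x y z u v w s t : R) :
    qf c (s * x + t * u) (s * y + t * v) (s * z + t * w) =
      s ^ 4 * qf c x y z + s ^ 3 * t * gdot c x y z u v w + s ^ 2 * t ^ 2 * Wf c x y z u v w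
        + s * t ^ 3 * gdot c u v w x y z + t ^ 4 * qf c u v w := by
  simp only [qf, gdot, Wf, qX, qY, qZ, hXX, hYY, hZZ, qXY, qXZ, qYZ]; ring

lemma euler (c : Fin 15 → R) (x y z : R) : gdot c x y z x y z = 4 * qf c x y z := by
  simp only [qf, gdot, qX, qY, qZ]; ring

lemma qf_smul (c : Fin 15 → R) (t x y z : R) : qf c (t * x) (t * y) (t * z) = t ^ 4 * qf c x y z := by
  simp only [qf]; ring
lemma qX_smul (c : Fin 15 → R) (t x y z : R) : qX c (t * x) (t * y) (t * z) = t ^ 3 * qX c x y z := by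
  simp only [qX]; ring
lemma qY_smul (c : Fin 15 → R) (t x y z : R) : qY c (t * x) (t * y) (t * z) = t ^ 3 * qY c x y z := by
  simp only [qY]; ring
lemma qZ_smul (c : Fin 15 → R) (t x y z : R) : qZ c (t * x) (t * y) (t * z) = t ^ 3 * qZ c x y z := by
  simp only [qZ]; ring

end forms

section
variable {k : Type*} [Field k]

/-- constant polynomials -/
def cC (c : Fin 15 → k) : Fin 15 → MvPolynomial (Fin 3) k := fun i => C (c i)

/-- the quartic as a polynomial -/
def Qp (c : Fin 15 → k) : MvPolynomial (Fin 3) k := qf (cC c) (X 0) (X 1) (X 2)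

lemma map_qf {A B : Type*} [CommRing A] [CommRing B] (φ : A →+* B) (c : Fin 15 → A) (x y z : A) :
    φ (qf c x y z) = qf (fun i => φ (c i)) (φ x) (φ y) (φ z) := by
  simp [qf]

lemma aeval_Qp {A : Type*} [CommRing A] [Algebra k A] (c : Fin 15 → k) (f : Fin 3 → A) :
    aeval f (Qp c) = qf (fun i => algebraMap k A (c i)) (f 0) (f 1) (f 2) := by
  simp [Qp, qf, cC]

lemma eval_qf (c : Fin 15 → k) (p : Fin 3 → k) (f g h : MvPolynomial (Fin 3) k) :
    eval p (qf (cC c) f g h) = qf c (eval p f) (eval p g) (eval p h) := by simp [qf, cC]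
lemma eval_qX (c : Fin 15 → k) (p : Fin 3 → k) (f g h : MvPolynomial (Fin 3) k) :
    eval p (qX (cC c) f g h) = qX c (eval p f) (eval p g) (eval p h) := by simp [qX, cC]
lemma eval_qY (c : Fin 15 → k) (p : Fin 3 → k) (f g h : MvPolynomial (Fin 3) k) :
    eval p (qY (cC c) f g h) = qY c (eval p f) (eval p g) (eval p h) := by simp [qY, cC]
lemma eval_qZ (c : Fin 15 → k) (p : Fin 3 → k) (f g h : MvPolynomial (Fin 3) k) :
    eval p (qZ (cC c) f g h) = qZ c (eval p f) (eval p g) (eval p h) := by simp [qZ, cC]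
lemma eval_hXX (c : Fin 15 → k) (p : Fin 3 → k) (f g h : MvPolynomial (Fin 3) k) :
    eval p (hXX (cC c) f g h) = hXX c (eval p f) (eval p g) (eval p h) := by simp [hXX, cC]
lemma eval_hYY (c : Fin 15 → k) (p : Fin 3 → k) (f g h : MvPolynomial (Fin 3) k) :
    eval p (hYY (cC c) f g h) = hYY c (eval p f) (eval p g) (eval p h) := by simp [hYY, cC]
lemma eval_hZZ (c : Fin 15 → k) (p : Fin 3 → k) (f g h : MvPolynomial (Fin 3) k) :
    eval p (hZZ (cC c) f g h) = hZZ c (eval p f) (eval p g) (eval p h) := by simp [hZZ, cC]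
lemma eval_qXY (c : Fin 15 → k) (p : Fin 3 → k) (f g h : MvPolynomial (Fin 3) k) :
    eval p (qXY (cC c) f g h) = qXY c (eval p f) (eval p g) (eval p h) := by simp [qXY, cC]
lemma eval_qXZ (c : Fin 15 → k) (p : Fin 3 → k) (f g h : MvPolynomial (Fin 3) k) :
    eval p (qXZ (cC c) f g h) = qXZ c (eval p f) (eval p g) (eval p h) := by simp [qXZ, cC]
lemma eval_qYZ (c : Fin 15 → k) (p : Fin 3 → k) (f g h : MvPolynomial (Fin 3) k) :
    eval p (qYZ (cC c) f g h) = qYZ c (eval p f) (eval p g) (eval p h) := by simp [qYZ, cC]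
lemma eval_hXXX (c : Fin 15 → k) (p : Fin 3 → k) (f g h : MvPolynomial (Fin 3) k) :
    eval p (hXXX (cC c) f g h) = hXXX c (eval p f) (eval p g) (eval p h) := by simp [hXXX, cC]
lemma eval_hXXY (c : Fin 15 → k) (p : Fin 3 → k) (f g h : MvPolynomial (Fin 3) k) :
    eval p (hXXY (cC c) f g h) = hXXY c (eval p f) (eval p g) (eval p h) := by simp [hXXY, cC]
lemma eval_hXYY (c : Fin 15 → k) (p : Fin 3 → k) (f g h : MvPolynomial (Fin 3) k) :
    eval p (hXYY (cC c) f g h) = hXYY c (eval p f) (eval p g) (eval p h) := by simp [hXYY, cC]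
lemma eval_hYYY (c : Fin 15 → k) (p : Fin 3 → k) (f g h : MvPolynomial (Fin 3) k) :
    eval p (hYYY (cC c) f g h) = hYYY c (eval p f) (eval p g) (eval p h) := by simp [hYYY, cC]
lemma eval_Q2 (c : Fin 15 → k) (p : Fin 3 → k) (f g h : MvPolynomial (Fin 3) k) :
    eval p (Q2 (cC c) f g h) = Q2 c (eval p f) (eval p g) (eval p h) := by
  simp [Q2, eval_hXX, eval_hYY, eval_qXY, eval_qX, eval_qY]
lemma eval_Q3 (c : Fin 15 → k) (p : Fin 3 → k) (f g h : MvPolynomial (Fin 3) k) :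
    eval p (Q3 (cC c) f g h) = Q3 c (eval p f) (eval p g) (eval p h) := by
  simp [Q3, eval_hXXX, eval_hXXY, eval_hXYY, eval_hYYY, eval_qX, eval_qY]
lemma eval_Qp (c : Fin 15 → k) (p : Fin 3 → k) :
    eval p (Qp c) = qf c (p 0) (p 1) (p 2) := by simp [Qp, eval_qf]

lemma pderiv_X_ne {i j : Fin 3} (h : j ≠ i) : pderiv i (X j : MvPolynomial (Fin 3) k) = 0 :=
  MvPolynomial.pderiv_X_of_ne h

lemma pd01 : pderiv (0 : Fin 3) (X 1 : MvPolynomial (Fin 3) k) = 0 := pderiv_X_ne (by decide)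
lemma pd02 : pderiv (0 : Fin 3) (X 2 : MvPolynomial (Fin 3) k) = 0 := pderiv_X_ne (by decide)
lemma pd10 : pderiv (1 : Fin 3) (X 0 : MvPolynomial (Fin 3) k) = 0 := pderiv_X_ne (by decide)
lemma pd12 : pderiv (1 : Fin 3) (X 2 : MvPolynomial (Fin 3) k) = 0 := pderiv_X_ne (by decide)
lemma pd20 : pderiv (2 : Fin 3) (X 0 : MvPolynomial (Fin 3) k) = 0 := pderiv_X_ne (by decide)
lemma pd21 : pderiv (2 : Fin 3) (X 1 : MvPolynomial (Fin 3) k) = 0 := pderiv_X_ne (by decide)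
lemma pd_qf0 (c : Fin 15 → k) : pderiv 0 (Qp c) = qX (cC c) (X 0) (X 1) (X 2) := by
  simp only [Qp, qf, qX, cC, map_add, Derivation.leibniz, Derivation.leibniz_pow, pderiv_C, pderiv_X_self, pd01, pd02,
    smul_eq_mul, nsmul_eq_mul, smul_zero]
  push_cast; ring
lemma pd_qf1 (c : Fin 15 → k) : pderiv 1 (Qp c) = qY (cC c) (X 0) (X 1) (X 2) := by
  simp only [Qp, qf, qY, cC, map_add, Derivation.leibniz, Derivation.leibniz_pow, pderiv_C, pderiv_X_self, pd10, pd12,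
    smul_eq_mul, nsmul_eq_mul, smul_zero]
  push_cast; ring
lemma pd_qf2 (c : Fin 15 → k) : pderiv 2 (Qp c) = qZ (cC c) (X 0) (X 1) (X 2) := by
  simp only [Qp, qf, qZ, cC, map_add, Derivation.leibniz, Derivation.leibniz_pow, pderiv_C, pderiv_X_self, pd20, pd21,
    smul_eq_mul, nsmul_eq_mul, smul_zero]
  push_cast; ring

lemma monomial_eq3 (d : Fin 3 →₀ ℕ) (r : k) :
    monomial d r = C r * X 0 ^ d 0 * X 1 ^ d 1 * X 2 ^ d 2 := by
  rw [monomial_eq, Finsupp.prod_fintype _ _ (by simp), Fin.prod_univ_three]; ring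

lemma exists_coeffs (q : MvPolynomial (Fin 3) k) (hq : q.IsHomogeneous 4) : ∃ c, q = Qp c := by
  rw [q.as_sum]
  refine Finset.sum_induction _ (fun f => ∃ c, f = Qp c) ?_ ?_ ?_
  · rintro _ _ ⟨c, rfl⟩ ⟨c', rfl⟩
    refine ⟨c + c', ?_⟩
    simp only [Qp, qf, cC, Pi.add_apply, C_add]; ring
  · exact ⟨0, by simp [Qp, qf, cC]⟩
  · intro d hd
    have h := hq (mem_support_iff.mp hd)
    rw [Finsupp.weight_apply, Finsupp.sum_fintype _ _ (by simp), Fin.sum_univ_three] at h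
    simp only [Pi.one_apply, smul_eq_mul, mul_one] at h
    rw [monomial_eq3]
    generalize coeff d q = r
    generalize d 0 = a at *
    generalize d 1 = b at *
    generalize d 2 = e at *
    refine ⟨fun n => if (a, b) = (![(4, 0), (3, 1), (3, 0), (2, 2), (2, 1), (2, 0), (1, 3), (1, 2), (1, 1),
      (1, 0), (0, 4), (0, 3), (0, 2), (0, 1), (0, 0)] : Fin 15 → ℕ × ℕ) n then r else 0, ?_⟩
    have ha : a ≤ 4 := by omega
    have hb : b ≤ 4 := by omega
    obtain rfl : e = 4 - a - b := by omega
    interval_cases a <;> interval_cases b <;> first | omega | simp [Qp, qf, cC, Prod.ext_iff]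

end

section
variable {k : Type*} [Field k]

/-- smooth plane quartic data -/
structure Good (c : Fin 15 → k) : Prop where
  prime : Prime (Qp c)
  hom : (Qp c).IsHomogeneous 4
  sm : ∀ x y z, qf c x y z = 0 → qX c x y z = 0 → qY c x y z = 0 → qZ c x y z = 0 →
    x = 0 ∧ y = 0 ∧ z = 0

lemma good_of [IsAlgClosed k] (c : Fin 15 → k) (hq0 : Qp c ≠ 0) (hq4 : (Qp c).IsHomogeneous 4)
    (hsm : ∀ pt : Fin 3 → k, pt ≠ 0 → eval pt (Qp c) = 0 → ∃ i, eval pt (pderiv i (Qp c)) ≠ 0) :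
    Good c := by
  refine ⟨smooth_prime _ hq0 hq4 hsm, hq4, ?_⟩
  intro x y z h h0 h1 h2
  by_contra hne
  obtain ⟨i, hi⟩ := hsm ![x, y, z] (by
    intro h'
    apply hne
    exact ⟨by simpa using congrFun h' 0, by simpa using congrFun h' 1, by simpa using congrFun h' 2⟩)
    (by rw [eval_Qp]; simpa using h)
  apply hi
  fin_cases i
  · simpa [pd_qf0, eval_qX] using h0
  · simpa [pd_qf1, eval_qY] using h1
  · simpa [pd_qf2, eval_qZ] using h2

variable [IsAlgClosed k]

lemma van_dvd {c : Fin 15 → k} (hc : Good c) (P : MvPolynomial (Fin 3) k)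
    (h : ∀ p : Fin 3 → k, qf c (p 0) (p 1) (p 2) = 0 → eval p P = 0) : Qp c ∣ P :=
  nullst _ hc.prime P (fun p hp => h p (by rwa [eval_Qp] at hp))

lemma dvd_van {c : Fin 15 → k} {P : MvPolynomial (Fin 3) k} (h : Qp c ∣ P)
    (p : Fin 3 → k) (hp : qf c (p 0) (p 1) (p 2) = 0) : eval p P = 0 := by
  obtain ⟨r, rfl⟩ := h
  rw [map_mul, eval_Qp, hp, zero_mul]

lemma van_low {c : Fin 15 → k} (hc : Good c) (P : MvPolynomial (Fin 3) k) (hd : P.totalDegree < 4)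
    (h : ∀ p : Fin 3 → k, qf c (p 0) (p 1) (p 2) = 0 → eval p P = 0) : P = 0 := by
  by_contra hP
  obtain ⟨r, rfl⟩ := van_dvd hc P h
  have hr : r ≠ 0 := right_ne_zero_of_mul hP
  rw [totalDegree_mul_of_isDomain hc.prime.ne_zero hr, hc.hom.totalDegree hc.prime.ne_zero] at hd
  omega

lemma van_low_hom {c : Fin 15 → k} (hc : Good c) (P : MvPolynomial (Fin 3) k) {n : ℕ} (hd : n < 4)
    (hP : P.IsHomogeneous n)
    (h : ∀ p : Fin 3 → k, qf c (p 0) (p 1) (p 2) = 0 → eval p P = 0) : P = 0 :=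
  van_low hc P (lt_of_le_of_lt hP.totalDegree_le hd) h

/-- if a product vanishes on the curve then one of the factors does -/
lemma van_mul {c : Fin 15 → k} (hc : Good c) (P Q : MvPolynomial (Fin 3) k)
    (h : ∀ p : Fin 3 → k, qf c (p 0) (p 1) (p 2) = 0 → eval p P * eval p Q = 0) :
    (∀ p : Fin 3 → k, qf c (p 0) (p 1) (p 2) = 0 → eval p P = 0) ∨
    (∀ p : Fin 3 → k, qf c (p 0) (p 1) (p 2) = 0 → eval p Q = 0) := by
  have := van_dvd hc (P * Q) (fun p hp => by rw [map_mul]; exact h p hp)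
  rcases hc.prime.dvd_or_dvd this with h | h
  · exact Or.inl (dvd_van h)
  · exact Or.inr (dvd_van h)

lemma zmul_van {c : Fin 15 → k} (hc : Good c) (Q : MvPolynomial (Fin 3) k) (n : ℕ)
    (h : ∀ p : Fin 3 → k, qf c (p 0) (p 1) (p 2) = 0 → p 2 ^ n * eval p Q = 0) :
    ∀ p : Fin 3 → k, qf c (p 0) (p 1) (p 2) = 0 → eval p Q = 0 := by
  have := van_mul hc (X 2 ) Q (fun p hp => by
    have := h p hp
    rcases mul_eq_zero.mp this with h | h
    · rw [eval_X, (pow_eq_zero_iff (Nat.succ_ne_zero n)).mp (by rw [pow_succ, h, zero_mul] : p 2 ^ (n + 1) = 0), zero_mul]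
    · rw [h, mul_zero])
  rcases this with h | h
  · exact absurd (van_low_hom hc _ (by norm_num) (isHomogeneous_X k 2) h) (X_ne_zero _)
  · exact h

lemma exists_z {c : Fin 15 → k} (hc : Good c) : ∃ p : Fin 3 → k, qf c (p 0) (p 1) (p 2) = 0 ∧ p 2 ≠ 0 := by
  by_contra! h
  exact absurd (van_low_hom hc _ (by norm_num) (isHomogeneous_X k 2) (fun p hp => by simpa using h p hp))
    (X_ne_zero _)

lemma quart_coeffs (a b c d e : k) (h : ∀ t : k, a + t * b + t ^ 2 * c + t ^ 3 * d + t ^ 4 * e = 0) :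
    a = 0 ∧ b = 0 ∧ c = 0 ∧ d = 0 ∧ e = 0 := by
  have hp : (Polynomial.C a + Polynomial.X * Polynomial.C b + Polynomial.X ^ 2 * Polynomial.C c
      + Polynomial.X ^ 3 * Polynomial.C d + Polynomial.X ^ 4 * Polynomial.C e : Polynomial k) = 0 := by
    apply Polynomial.funext
    intro t
    simp
    linear_combination h t
  have hc := fun n => congrArg (fun f => Polynomial.coeff f n) hp
  refine ⟨?_, ?_, ?_, ?_, ?_⟩
  · simpa using hc 0
  · simpa [Polynomial.coeff_X, Polynomial.coeff_C] using hc 1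
  · simpa [Polynomial.coeff_X, Polynomial.coeff_C] using hc 2
  · simpa [Polynomial.coeff_X, Polynomial.coeff_C] using hc 3
  · simpa [Polynomial.coeff_X, Polynomial.coeff_C] using hc 4

/-- a smooth quartic contains no line -/
lemma no_line {c : Fin 15 → k} (hc : Good c) (x y z u v w : k)
    (hn : ¬ (y * w - z * v = 0 ∧ z * u - x * w = 0 ∧ x * v - y * u = 0))
    (h : ∀ s t : k, qf c (s * x + t * u) (s * y + t * v) (s * z + t * w) = 0) : False := by
  -- gradient kills both directions along the line
  have gp : ∀ s t, gdot c (s * x + t * u) (s * y + t * v) (s * z + t * w) x y z = 0 := by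
    intro s t
    have := quart_coeffs _ _ _ _ _ (fun ε => by
      have h1 := h (s + ε) t
      have h2 := taylor c (s * x + t * u) (s * y + t * v) (s * z + t * w) x y z 1 ε
      rw [show (1 : k) * (s * x + t * u) + ε * x = (s + ε) * x + t * u by ring,
        show (1 : k) * (s * y + t * v) + ε * y = (s + ε) * y + t * v by ring,
        show (1 : k) * (s * z + t * w) + ε * z = (s + ε) * z + t * w by ring, h1] at h2
      simp only [one_pow, one_mul] at h2
      exact h2.symm)
    exact this.2.1
  have gv : ∀ s t, gdot c (s * x + t * u) (s * y + t * v) (s * z + t * w) u v w = 0 := by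
    intro s t
    have := quart_coeffs _ _ _ _ _ (fun ε => by
      have h1 := h s (t + ε)
      have h2 := taylor c (s * x + t * u) (s * y + t * v) (s * z + t * w) u v w 1 ε
      rw [show (1 : k) * (s * x + t * u) + ε * u = s * x + (t + ε) * u by ring,
        show (1 : k) * (s * y + t * v) + ε * v = s * y + (t + ε) * v by ring,
        show (1 : k) * (s * z + t * w) + ε * w = s * z + (t + ε) * w by ring, h1] at h2
      simp only [one_pow, one_mul] at h2
      exact h2.symm)
    exact this.2.1
  set n0 := y * w - z * v with hn0
  set n1 := z * u - x * w with hn1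
  set n2 := x * v - y * u with hn2
  -- main step: a point on the line with one vanishing partial derivative
  have main : ∀ G : MvPolynomial (Fin 3) k, eval 0 G = 0 → (∀ (p : Fin 3 → k),
      (qX c (p 0) (p 1) (p 2) * n1 = qY c (p 0) (p 1) (p 2) * n0) →
      (qX c (p 0) (p 1) (p 2) * n2 = qZ c (p 0) (p 1) (p 2) * n0) →
      (qY c (p 0) (p 1) (p 2) * n2 = qZ c (p 0) (p 1) (p 2) * n1) → eval p G = 0 → 
      qX c (p 0) (p 1) (p 2) = 0 ∧ qY c (p 0) (p 1) (p 2) = 0 ∧ qZ c (p 0) (p 1) (p 2) = 0) → False := by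
    intro G hG0 hG
    obtain ⟨p, hp0, hp1, hp2⟩ := bezout_aux (C n0 * X 0 + C n1 * X 1 + C n2 * X 2) G (by simp) hG0
    simp only [map_add, map_mul, eval_C, eval_X] at hp1
    -- p is on the line
    have hl : ∃ m s t : k, m ≠ 0 ∧ m * p 0 = s * x + t * u ∧ m * p 1 = s * y + t * v ∧
        m * p 2 = s * z + t * w := by
      by_cases e2 : n2 = 0
      · by_cases e1 : n1 = 0
        · have e0 : n0 ≠ 0 := fun e0 => hn ⟨e0, e1, e2⟩
          refine ⟨n0, p 1 * w - p 2 * v, y * p 2 - z * p 1, e0, ?_, ?_, ?_⟩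
          · rw [hn0, hn1, hn2] at hp1; linear_combination hp1 
          · rw [hn0]; ring
          · rw [hn0]; ring
        · refine ⟨n1, p 2 * u - p 0 * w, z * p 0 - x * p 2, e1, ?_, ?_, ?_⟩
          · rw [hn1]; ring
          · rw [hn0, hn1, hn2] at hp1; linear_combination hp1 
          · rw [hn1]; ring
      · refine ⟨n2, p 0 * v - p 1 * u, x * p 1 - y * p 0, e2, ?_, ?_, ?_⟩
        · rw [hn2]; ring
        · rw [hn2]; ring
        · rw [hn0, hn1, hn2] at hp1; linear_combination hp1 
    obtain ⟨m, s, t, hm, e0, e1, e2⟩ := hl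
    have a := gp s t
    have b := gv s t
    have q0 := h s t
    rw [← e0, ← e1, ← e2] at a b q0
    rw [qf_smul] at q0
    simp only [gdot, qX_smul, qY_smul, qZ_smul] at a b
    have m3 : m ^ 3 ≠ 0 := pow_ne_zero _ hm
    have a' : qX c (p 0) (p 1) (p 2) * x + qY c (p 0) (p 1) (p 2) * y + qZ c (p 0) (p 1) (p 2) * z = 0 := by
      apply mul_left_cancel₀ m3; linear_combination a
    have b' : qX c (p 0) (p 1) (p 2) * u + qY c (p 0) (p 1) (p 2) * v + qZ c (p 0) (p 1) (p 2) * w = 0 := by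
      apply mul_left_cancel₀ m3; linear_combination b
    have q1 := (mul_eq_zero.mp q0).resolve_left (pow_ne_zero _ hm)
    obtain ⟨f0, f1, f2⟩ := hG p (by rw [hn1, hn0]; linear_combination z * b' - w * a')
      (by rw [hn2, hn0]; linear_combination v * a' - y * b')
      (by rw [hn2, hn1]; linear_combination x * b' - u * a') hp2
    obtain ⟨z0, z1, z2⟩ := hc.sm _ _ _ q1 f0 f1 f2
    apply hp0
    ext i; fin_cases i <;> assumption
  by_cases e0 : n0 = 0
  · by_cases e1 : n1 = 0
    · have e2 : n2 ≠ 0 := fun e2 => hn ⟨e0, e1, e2⟩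
      refine main (qZ (cC c) (X 0) (X 1) (X 2)) (by simp [eval_qZ, qZ]) ?_
      intro p h1 h2 h3 h4
      rw [eval_qZ] at h4; simp only [eval_X] at h4
      rw [h4] at h2 h3
      refine ⟨by simpa [e2] using h2, by simpa [e2] using h3, h4⟩
    · refine main (qY (cC c) (X 0) (X 1) (X 2)) (by simp [eval_qY, qY]) ?_
      intro p h1 h2 h3 h4
      rw [eval_qY] at h4; simp only [eval_X] at h4
      rw [h4] at h1 h3
      refine ⟨by simpa [e1] using h1, h4, by simpa [e1, eq_comm] using h3⟩
  · refine main (qX (cC c) (X 0) (X 1) (X 2)) (by simp [eval_qX, qX]) ?_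
    intro p h1 h2 h3 h4
    rw [eval_qX] at h4; simp only [eval_X] at h4
    rw [h4] at h1 h2
    refine ⟨h4, by simpa [e0, eq_comm] using h1, by simpa [e0, eq_comm] using h2⟩

/-- tangential derivatives vanish on the curve -/
lemma tang {c : Fin 15 → k} (hc : Good c) (P : MvPolynomial (Fin 3) k)
    (h : ∀ p : Fin 3 → k, qf c (p 0) (p 1) (p 2) = 0 → eval p P = 0)
    (p : Fin 3 → k) (hp : qf c (p 0) (p 1) (p 2) = 0) :
    eval p (pderiv 0 P) * qY c (p 0) (p 1) (p 2) - eval p (pderiv 1 P) * qX c (p 0) (p 1) (p 2) = 0 := by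
  obtain ⟨r, rfl⟩ := van_dvd hc P h
  simp only [Derivation.leibniz, map_add, smul_eq_mul, map_mul, pd_qf0, pd_qf1, eval_qX, eval_qY, eval_X,
    eval_Qp, hp]
  ring

end

section
variable {k : Type*} [Field k]

lemma pdn2 (i : Fin 3) : pderiv i (2 : MvPolynomial (Fin 3) k) = 0 := by
  rw [← map_ofNat (C : k →+* MvPolynomial (Fin 3) k)]; exact pderiv_C
lemma pdn3 (i : Fin 3) : pderiv i (3 : MvPolynomial (Fin 3) k) = 0 := by
  rw [← map_ofNat (C : k →+* MvPolynomial (Fin 3) k)]; exact pderiv_C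
lemma pdn4 (i : Fin 3) : pderiv i (4 : MvPolynomial (Fin 3) k) = 0 := by
  rw [← map_ofNat (C : k →+* MvPolynomial (Fin 3) k)]; exact pderiv_C
lemma pdn6 (i : Fin 3) : pderiv i (6 : MvPolynomial (Fin 3) k) = 0 := by
  rw [← map_ofNat (C : k →+* MvPolynomial (Fin 3) k)]; exact pderiv_C

lemma pd_qX0 (c : Fin 15 → k) : pderiv 0 (qX (cC c) (X 0) (X 1) (X 2)) = 2 * hXX (cC c) (X 0) (X 1) (X 2) := by
  simp only [qX, hXX, cC, map_add, Derivation.leibniz, Derivation.leibniz_pow, pderiv_C, pderiv_X_self, pd01, pd02, pdn2, pdn3, pdn4, pdn6,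
    smul_eq_mul, nsmul_eq_mul, smul_zero]
  push_cast; ring
lemma pd_qX1 (c : Fin 15 → k) : pderiv 1 (qX (cC c) (X 0) (X 1) (X 2)) = qXY (cC c) (X 0) (X 1) (X 2) := by
  simp only [qX, qXY, cC, map_add, Derivation.leibniz, Derivation.leibniz_pow, pderiv_C, pderiv_X_self, pd10, pd12, pdn2, pdn3, pdn4, pdn6,
    smul_eq_mul, nsmul_eq_mul, smul_zero]
  push_cast; ring
lemma pd_qY0 (c : Fin 15 → k) : pderiv 0 (qY (cC c) (X 0) (X 1) (X 2)) = qXY (cC c) (X 0) (X 1) (X 2) := by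
  simp only [qY, qXY, cC, map_add, Derivation.leibniz, Derivation.leibniz_pow, pderiv_C, pderiv_X_self, pd01, pd02, pdn2, pdn3, pdn4, pdn6,
    smul_eq_mul, nsmul_eq_mul, smul_zero]
  push_cast; ring
lemma pd_qY1 (c : Fin 15 → k) : pderiv 1 (qY (cC c) (X 0) (X 1) (X 2)) = 2 * hYY (cC c) (X 0) (X 1) (X 2) := by
  simp only [qY, hYY, cC, map_add, Derivation.leibniz, Derivation.leibniz_pow, pderiv_C, pderiv_X_self, pd10, pd12, pdn2, pdn3, pdn4, pdn6,
    smul_eq_mul, nsmul_eq_mul, smul_zero]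
  push_cast; ring
lemma pd_hXX0 (c : Fin 15 → k) : pderiv 0 (hXX (cC c) (X 0) (X 1) (X 2)) = 3 * hXXX (cC c) (X 0) (X 1) (X 2) := by
  simp only [hXX, hXXX, cC, map_add, Derivation.leibniz, Derivation.leibniz_pow, pderiv_C, pderiv_X_self, pd01, pd02, pdn2, pdn3, pdn4, pdn6,
    smul_eq_mul, nsmul_eq_mul, smul_zero]
  push_cast; ring
lemma pd_hXX1 (c : Fin 15 → k) : pderiv 1 (hXX (cC c) (X 0) (X 1) (X 2)) = hXXY (cC c) (X 0) (X 1) (X 2) := by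
  simp only [hXX, hXXY, cC, map_add, Derivation.leibniz, Derivation.leibniz_pow, pderiv_C, pderiv_X_self, pd10, pd12, pdn2, pdn3, pdn4, pdn6,
    smul_eq_mul, nsmul_eq_mul, smul_zero]
  push_cast; ring
lemma pd_hYY0 (c : Fin 15 → k) : pderiv 0 (hYY (cC c) (X 0) (X 1) (X 2)) = hXYY (cC c) (X 0) (X 1) (X 2) := by
  simp only [hYY, hXYY, cC, map_add, Derivation.leibniz, Derivation.leibniz_pow, pderiv_C, pderiv_X_self, pd01, pd02, pdn2, pdn3, pdn4, pdn6,
    smul_eq_mul, nsmul_eq_mul, smul_zero]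
  push_cast; ring
lemma pd_hYY1 (c : Fin 15 → k) : pderiv 1 (hYY (cC c) (X 0) (X 1) (X 2)) = 3 * hYYY (cC c) (X 0) (X 1) (X 2) := by
  simp only [hYY, hYYY, cC, map_add, Derivation.leibniz, Derivation.leibniz_pow, pderiv_C, pderiv_X_self, pd10, pd12, pdn2, pdn3, pdn4, pdn6,
    smul_eq_mul, nsmul_eq_mul, smul_zero]
  push_cast; ring
lemma pd_qXY0 (c : Fin 15 → k) : pderiv 0 (qXY (cC c) (X 0) (X 1) (X 2)) = 2 * hXXY (cC c) (X 0) (X 1) (X 2) := by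
  simp only [qXY, hXXY, cC, map_add, Derivation.leibniz, Derivation.leibniz_pow, pderiv_C, pderiv_X_self, pd01, pd02, pdn2, pdn3, pdn4, pdn6,
    smul_eq_mul, nsmul_eq_mul, smul_zero]
  push_cast; ring
lemma pd_qXY1 (c : Fin 15 → k) : pderiv 1 (qXY (cC c) (X 0) (X 1) (X 2)) = 2 * hXYY (cC c) (X 0) (X 1) (X 2) := by
  simp only [qXY, hXYY, cC, map_add, Derivation.leibniz, Derivation.leibniz_pow, pderiv_C, pderiv_X_self, pd10, pd12, pdn2, pdn3, pdn4, pdn6,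
    smul_eq_mul, nsmul_eq_mul, smul_zero]
  push_cast; ring
/-- derivative of `Q2` along the tangent field -/
lemma D_Q2 (c : Fin 15 → k) (p : Fin 3 → k) :
    eval p (pderiv 0 (Q2 (cC c) (X 0) (X 1) (X 2))) * qY c (p 0) (p 1) (p 2)
      - eval p (pderiv 1 (Q2 (cC c) (X 0) (X 1) (X 2))) * qX c (p 0) (p 1) (p 2)
      = 3 * Q3 c (p 0) (p 1) (p 2) := by
  simp only [Q2, Q3, map_add, map_sub, Derivation.leibniz, Derivation.leibniz_pow, smul_eq_mul, nsmul_eq_mul, 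
    pd_qX0, pd_qX1, pd_qY0, pd_qY1, pd_hXX0, pd_hXX1, pd_hYY0, pd_hYY1, pd_qXY0, pd_qXY1, map_mul, map_pow,
    eval_qX, eval_qY, eval_hXX, eval_hYY, eval_qXY, eval_hXXX, eval_hXXY, eval_hXYY, eval_hYYY, eval_X, map_ofNat, map_natCast]
  push_cast
  ring

variable [IsAlgClosed k]

/-- generic flex condition -/
def Flex (c : Fin 15 → k) : Prop := ∀ p : Fin 3 → k, qf c (p 0) (p 1) (p 2) = 0 → Q2 c (p 0) (p 1) (p 2) = 0

lemma flex_Q3 {c : Fin 15 → k} (hc : Good c) (hF : Flex c) (h3 : (3 : k) ≠ 0)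
    (p : Fin 3 → k) (hp : qf c (p 0) (p 1) (p 2) = 0) : Q3 c (p 0) (p 1) (p 2) = 0 := by
  have h := tang hc (Q2 (cC c) (X 0) (X 1) (X 2)) (fun p hp => by
    rw [eval_Q2]; simpa using hF p hp) p hp
  rw [D_Q2] at h
  exact (mul_eq_zero.mp h).resolve_left h3

/-- the fourth order term along the tangent direction -/
def Q4 {R : Type*} [CommRing R] (c : Fin 15 → R) (x y z : R) : R := qf c (qY c x y z) (- qX c x y z) 0

lemma gdot_tau (c : Fin 15 → k) (x y z : k) : gdot c (qY c x y z) (- qX c x y z) 0 x y z = Q3 c x y z := by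
  generalize hA : qY c x y z = A
  generalize hB : qX c x y z = B
  simp only [Q3, hA, hB]
  simp only [gdot, qX, qY, qZ, hXXX, hXXY, hXYY, hYYY]
  ring

lemma D_Q3 (c : Fin 15 → k) (p : Fin 3 → k) :
    eval p (pderiv 0 (Q3 (cC c) (X 0) (X 1) (X 2))) * qY c (p 0) (p 1) (p 2)
      - eval p (pderiv 1 (Q3 (cC c) (X 0) (X 1) (X 2))) * qX c (p 0) (p 1) (p 2)
      = 4 * Q4 c (p 0) (p 1) (p 2) + 
        (3 * hXXX c (p 0) (p 1) (p 2) * qY c (p 0) (p 1) (p 2) ^ 2 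
          - 2 * hXXY c (p 0) (p 1) (p 2) * qY c (p 0) (p 1) (p 2) * qX c (p 0) (p 1) (p 2)
          + hXYY c (p 0) (p 1) (p 2) * qX c (p 0) (p 1) (p 2) ^ 2) * 
          (qXY c (p 0) (p 1) (p 2) * qY c (p 0) (p 1) (p 2) - 2 * hYY c (p 0) (p 1) (p 2) * qX c (p 0) (p 1) (p 2))
        + (- hXXY c (p 0) (p 1) (p 2) * qY c (p 0) (p 1) (p 2) ^ 2 
          + 2 * hXYY c (p 0) (p 1) (p 2) * qY c (p 0) (p 1) (p 2) * qX c (p 0) (p 1) (p 2)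
          - 3 * hYYY c (p 0) (p 1) (p 2) * qX c (p 0) (p 1) (p 2) ^ 2) * 
          (2 * hXX c (p 0) (p 1) (p 2) * qY c (p 0) (p 1) (p 2) - qXY c (p 0) (p 1) (p 2) * qX c (p 0) (p 1) (p 2)) := by
  have e1 : ∀ i, pderiv i (hXXX (cC c) (X 0) (X 1) (X 2)) = ![4 * C (c 0), C (c 1), C (c 2)] i := by
    intro i; fin_cases i <;> simp [hXXX, cC, Derivation.leibniz, pd01, pd02, pd10, pd12, pd20, pd21, pdn2, pdn3, pdn4, pdn6]
  have e2 : ∀ i, pderiv i (hXXY (cC c) (X 0) (X 1) (X 2)) = ![3 * C (c 1), 2 * C (c 3), C (c 4)] i := by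
    intro i; fin_cases i <;> simp [hXXY, cC, Derivation.leibniz, pd01, pd02, pd10, pd12, pd20, pd21, pdn2, pdn3, pdn4, pdn6]
  have e3 : ∀ i, pderiv i (hXYY (cC c) (X 0) (X 1) (X 2)) = ![2 * C (c 3), 3 * C (c 6), C (c 7)] i := by
    intro i; fin_cases i <;> simp [hXYY, cC, Derivation.leibniz, pd01, pd02, pd10, pd12, pd20, pd21, pdn2, pdn3, pdn4, pdn6]
  have e4 : ∀ i, pderiv i (hYYY (cC c) (X 0) (X 1) (X 2)) = ![C (c 6), 4 * C (c 10), C (c 11)] i := by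
    intro i; fin_cases i <;> simp [hYYY, cC, Derivation.leibniz, pd01, pd02, pd10, pd12, pd20, pd21, pdn2, pdn3, pdn4, pdn6]
  simp only [Q3, map_add, map_sub, Derivation.leibniz, Derivation.leibniz_pow, smul_eq_mul, nsmul_eq_mul, 
    pd_qX0, pd_qX1, pd_qY0, pd_qY1, e1, e2, e3, e4, map_mul, map_pow, Matrix.cons_val_zero, Matrix.cons_val_one,
    eval_qX, eval_qY, eval_hXX, eval_hYY, eval_qXY, eval_hXXX, eval_hXXY, eval_hXYY, eval_hYYY, eval_X, map_ofNat, map_natCast, eval_C]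
  push_cast
  simp only [Q4, qf]
  ring

end

section
variable {k : Type*} [Field k]

lemma W_tau (c : Fin 15 → k) (x y z : k) : Wf c x y z (qY c x y z) (- qX c x y z) 0 = Q2 c x y z := by
  simp only [Wf, Q2]; ring

lemma g_tau (c : Fin 15 → k) (x y z : k) : gdot c x y z (qY c x y z) (- qX c x y z) 0 = 0 := by
  simp only [gdot]; ring

lemma eulX (c : Fin 15 → k) (x y z : k) :
    3 * qX c x y z = 2 * x * hXX c x y z + y * qXY c x y z + z * qXZ c x y z := by
  simp only [qX, hXX, qXY, qXZ]; ring
lemma eulY (c : Fin 15 → k) (x y z : k) :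
    3 * qY c x y z = x * qXY c x y z + 2 * y * hYY c x y z + z * qYZ c x y z := by
  simp only [qY, hYY, qXY, qYZ]; ring
lemma eulZ (c : Fin 15 → k) (x y z : k) :
    3 * qZ c x y z = x * qXZ c x y z + y * qYZ c x y z + 2 * z * hZZ c x y z := by
  simp only [qZ, hZZ, qXZ, qYZ]; ring

variable [IsAlgClosed k]

lemma flex_ne6 {c : Fin 15 → k} (hc : Good c) (hF : Flex c) (h3 : (3 : k) ≠ 0) (h2 : (2 : k) ≠ 0) : False := by
  obtain ⟨p, hp, hz⟩ := exists_z hc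
  have q2 := hF p hp
  have q3 := flex_Q3 hc hF h3 p hp
  have d3 := tang hc (Q3 (cC c) (X 0) (X 1) (X 2)) (fun p hp => by
    rw [eval_Q3]; simpa using flex_Q3 hc hF h3 p hp) p hp
  rw [D_Q3] at d3
  have htau : ¬ (qY c (p 0) (p 1) (p 2) = 0 ∧ qX c (p 0) (p 1) (p 2) = 0) := by
    rintro ⟨hA, hB⟩
    have he := euler c (p 0) (p 1) (p 2)
    simp only [gdot, hA, hB, hp] at he
    have hC : qZ c (p 0) (p 1) (p 2) = 0 := by
      apply mul_right_cancel₀ hz; linear_combination he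
    exact hz (hc.sm _ _ _ hp hB hA hC).2.2
  have h4 : (4 : k) ≠ 0 := by
    have : (4 : k) = 2 * 2 := by norm_num
    rw [this]; exact mul_ne_zero h2 h2
  have q4 : Q4 c (p 0) (p 1) (p 2) = 0 := by
    rw [not_and_or] at htau
    simp only [Q2, Q3] at q2 q3
    generalize Q4 c (p 0) (p 1) (p 2) = Q at *
    generalize qX c (p 0) (p 1) (p 2) = B at *
    generalize qY c (p 0) (p 1) (p 2) = A at *
    generalize hXX c (p 0) (p 1) (p 2) = a at *
    generalize hYY c (p 0) (p 1) (p 2) = d at *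
    generalize qXY c (p 0) (p 1) (p 2) = b at *
    generalize hXXX c (p 0) (p 1) (p 2) = e at *
    generalize hXXY c (p 0) (p 1) (p 2) = f at *
    generalize hXYY c (p 0) (p 1) (p 2) = g at *
    generalize hYYY c (p 0) (p 1) (p 2) = h at *
    rcases htau with hA | hB
    · have : 4 * A * Q = 0 := by
        linear_combination A * d3 - (- f * A ^ 2 + 2 * g * A * B - 3 * h * B ^ 2) * 2 * q2
          - 3 * (b * A - 2 * d * B) * q3
      simpa [h4, hA] using this
    · have : 4 * B * Q = 0 := by
        linear_combination B * d3 + (3 * e * A ^ 2 - 2 * f * A * B + g * B ^ 2) * 2 * q2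
          - 3 * (2 * a * A - b * B) * q3
      simpa [h4, hB] using this
  refine no_line hc (p 0) (p 1) (p 2) (qY c (p 0) (p 1) (p 2)) (- qX c (p 0) (p 1) (p 2)) 0 ?_ ?_
  · rintro ⟨h1, h2, -⟩
    apply htau
    constructor
    · apply mul_left_cancel₀ hz; linear_combination h2
    · apply mul_left_cancel₀ hz; linear_combination h1
  · intro s t
    rw [taylor, W_tau, g_tau, gdot_tau, hp, q2, q3]
    change _ + t ^ 4 * Q4 c (p 0) (p 1) (p 2) = 0
    rw [q4]; ring

lemma flex_two {c : Fin 15 → k} (hc : Good c) (hF : Flex c) (h2 : (2 : k) = 0) : False := by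
  have h3 : (3 : k) ≠ 0 := by
    have : (3 : k) = 1 := by linear_combination h2
    rw [this]; exact one_ne_zero
  -- the vector e
  have gX : ∀ x y z, qX c x y z = y * qXY c x y z - z * qXZ c x y z := fun x y z => by
    linear_combination eulX c x y z + (x * hXX c x y z + z * qXZ c x y z - qX c x y z) * h2
  have gY : ∀ x y z, qY c x y z = z * qYZ c x y z - x * qXY c x y z := fun x y z => by
    linear_combination eulY c x y z + (y * hYY c x y z + x * qXY c x y z - qY c x y z) * h2
  have gZ : ∀ x y z, qZ c x y z = x * qXZ c x y z - y * qYZ c x y z := fun x y z => by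
    linear_combination eulZ c x y z + (z * hZZ c x y z + y * qYZ c x y z - qZ c x y z) * h2
  have ge : ∀ x y z, gdot c x y z (qYZ c x y z) (qXZ c x y z) (qXY c x y z) = 0 := fun x y z => by
    simp only [gdot, gX, gY, gZ]
    ring
  have key : ∀ p : Fin 3 → k, qf c (p 0) (p 1) (p 2) = 0 →
      p 2 ^ 2 * Wf c (p 0) (p 1) (p 2) (qYZ c (p 0) (p 1) (p 2)) (qXZ c (p 0) (p 1) (p 2)) (qXY c (p 0) (p 1) (p 2)) = 0 ∧
      p 2 ^ 3 * gdot c (qYZ c (p 0) (p 1) (p 2)) (qXZ c (p 0) (p 1) (p 2)) (qXY c (p 0) (p 1) (p 2)) (p 0) (p 1) (p 2) = 0 := by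
    intro p hp
    have q2 := hF p hp
    have q3 := flex_Q3 hc hF h3 p hp
    have := quart_coeffs 0 0
      (p 2 ^ 2 * Wf c (p 0) (p 1) (p 2) (qYZ c (p 0) (p 1) (p 2)) (qXZ c (p 0) (p 1) (p 2)) (qXY c (p 0) (p 1) (p 2)))
      (p 2 ^ 3 * gdot c (qYZ c (p 0) (p 1) (p 2)) (qXZ c (p 0) (p 1) (p 2)) (qXY c (p 0) (p 1) (p 2)) (p 0) (p 1) (p 2))
      (p 2 ^ 4 * qf c (qYZ c (p 0) (p 1) (p 2)) (qXZ c (p 0) (p 1) (p 2)) (qXY c (p 0) (p 1) (p 2))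
        - qf c (qY c (p 0) (p 1) (p 2)) (- qX c (p 0) (p 1) (p 2)) 0) (fun t => by
      have a := taylor c (p 0) (p 1) (p 2) (qYZ c (p 0) (p 1) (p 2)) (qXZ c (p 0) (p 1) (p 2)) (qXY c (p 0) (p 1) (p 2)) 1 (t * p 2)
      have b := taylor c (p 0) (p 1) (p 2) (qY c (p 0) (p 1) (p 2)) (- qX c (p 0) (p 1) (p 2)) 0 (1 + t * qXY c (p 0) (p 1) (p 2)) t
      rw [W_tau, g_tau, gdot_tau, hp, q2, q3] at b
      rw [ge, hp] at a
      rw [show (1 : k) * p 0 + t * p 2 * qYZ c (p 0) (p 1) (p 2) = (1 + t * qXY c (p 0) (p 1) (p 2)) * p 0 + t * qY c (p 0) (p 1) (p 2) by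
            rw [gY]; ring,
          show (1 : k) * p 1 + t * p 2 * qXZ c (p 0) (p 1) (p 2) = (1 + t * qXY c (p 0) (p 1) (p 2)) * p 1 + t * - qX c (p 0) (p 1) (p 2) by
            rw [gX]; ring,
          show (1 : k) * p 2 + t * p 2 * qXY c (p 0) (p 1) (p 2) = (1 + t * qXY c (p 0) (p 1) (p 2)) * p 2 + t * 0 by ring, b] at a
      linear_combination -a)
    exact ⟨this.2.2.1, this.2.2.2.1⟩
  have hU := zmul_van hc (Wf (cC c) (X 0) (X 1) (X 2) (qYZ (cC c) (X 0) (X 1) (X 2)) (qXZ (cC c) (X 0) (X 1) (X 2))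
    (qXY (cC c) (X 0) (X 1) (X 2))) 2 (fun p hp => by
      have := (key p hp).1
      simpa only [Wf, map_add, map_mul, map_pow, eval_hXX, eval_hYY, eval_hZZ, eval_qXY, eval_qXZ, eval_qYZ, eval_X] using this)
  have hV := zmul_van hc (gdot (cC c) (qYZ (cC c) (X 0) (X 1) (X 2)) (qXZ (cC c) (X 0) (X 1) (X 2))
    (qXY (cC c) (X 0) (X 1) (X 2)) (X 0) (X 1) (X 2)) 3 (fun p hp => by
      have := (key p hp).2
      simpa only [gdot, map_add, map_mul, eval_qX, eval_qY, eval_qZ, eval_qXY, eval_qXZ, eval_qYZ, eval_X] using this)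
  obtain ⟨p, hp0, hp, hpe⟩ := bezout_aux (Qp c) (qf (cC c) (qYZ (cC c) (X 0) (X 1) (X 2)) (qXZ (cC c) (X 0) (X 1) (X 2))
    (qXY (cC c) (X 0) (X 1) (X 2))) (by rw [eval_Qp]; simp [qf]) (by 
      simp only [eval_qf, eval_qYZ, eval_qXZ, eval_qXY]; simp [qf, qYZ, qXZ, qXY])
  rw [eval_Qp] at hp
  simp only [eval_qf, eval_qYZ, eval_qXZ, eval_qXY, eval_X] at hpe
  have u := hU p hp
  have v := hV p hp
  simp only [Wf, map_add, map_mul, map_pow, eval_hXX, eval_hYY, eval_hZZ, eval_qXY, eval_qXZ, eval_qYZ, eval_X] at u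
  simp only [gdot, map_add, map_mul, eval_qX, eval_qY, eval_qZ, eval_qXY, eval_qXZ, eval_qYZ, eval_X] at v
  refine no_line hc (p 0) (p 1) (p 2) (qYZ c (p 0) (p 1) (p 2)) (qXZ c (p 0) (p 1) (p 2)) (qXY c (p 0) (p 1) (p 2)) ?_ ?_
  · rintro ⟨h0, h1, h2⟩
    obtain ⟨a, b, d⟩ := hc.sm _ _ _ hp (by rw [gX]; exact h0) (by rw [gY]; exact h1) (by rw [gZ]; exact h2)
    apply hp0
    ext i; fin_cases i <;> assumption
  · intro s t
    rw [taylor, ge, hp, hpe]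
    simp only [gdot, Wf]
    rw [u, v]; ring

lemma flex_three {c : Fin 15 → k} (hc : Good c) (hF : Flex c) : (3 : k) = 0 := by
  by_contra h3
  by_cases h2 : (2 : k) = 0
  · exact flex_two hc hF h2
  · exact flex_ne6 hc hF h3 h2

end

section
variable {k : Type*} [Field k]

lemma Q2_smul (c : Fin 15 → k) (t x y z : k) : Q2 c (t * x) (t * y) (t * z) = t ^ 8 * Q2 c x y z := by
  simp only [Q2, qX_smul, qY_smul]
  simp only [hXX, hYY, qXY]; ring

lemma lin_form (L : MvPolynomial (Fin 2) k) (hL : L.IsHomogeneous 1) : ∃ l m : k, L = C l * X 0 + C m * X 1 := by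
  rw [L.as_sum]
  refine Finset.sum_induction _ (fun f => ∃ l m, f = C l * X 0 + C m * X 1) ?_ ?_ ?_
  · rintro _ _ ⟨l, m, rfl⟩ ⟨l', m', rfl⟩
    exact ⟨l + l', m + m', by simp only [C_add]; ring⟩
  · exact ⟨0, 0, by simp⟩
  · intro d hd
    have h := hL (mem_support_iff.mp hd)
    rw [Finsupp.weight_apply, Finsupp.sum_fintype _ _ (by simp), Fin.sum_univ_two] at h
    simp only [Pi.one_apply, smul_eq_mul, mul_one] at h
    rw [monomial_eq, Finsupp.prod_fintype _ _ (by simp), Fin.prod_univ_two]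
    generalize coeff d L = r
    generalize d 0 = a at *
    generalize d 1 = b at *
    have : (a = 1 ∧ b = 0) ∨ (a = 0 ∧ b = 1) := by omega
    rcases this with ⟨rfl, rfl⟩ | ⟨rfl, rfl⟩
    · exact ⟨r, 0, by simp⟩
    · exact ⟨0, r, by simp⟩

lemma cross_ne (a b : Fin 3 → k) (h : LinearIndependent k ![a, b]) :
    ¬ (a 1 * b 2 - a 2 * b 1 = 0 ∧ a 2 * b 0 - a 0 * b 2 = 0 ∧ a 0 * b 1 - a 1 * b 0 = 0) := by
  rintro ⟨h0, h1, h2⟩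
  rw [LinearIndependent.pair_iff] at h
  have key : ∀ i, a i = 0 := by
    intro i
    have := (h (b i) (- a i) (by
      ext j
      fin_cases i <;> fin_cases j <;> simp <;> first | ring1 | linear_combination h0 | linear_combination h1 | linear_combination h2 | linear_combination -h0 | linear_combination -h1 | linear_combination -h2)).2
    simpa using this
  have := (h 1 0 (by ext j; simp [key])).1
  exact one_ne_zero this

variable [IsAlgClosed k]

lemma infl_point {c : Fin 15 → k} (hc : Good c) (d : Fin 3 → k) (h : IsInflectionLine (Qp c) d) :
    ∃ p : Fin 3 → k, p ≠ 0 ∧ qf c (p 0) (p 1) (p 2) = 0 ∧ Q2 c (p 0) (p 1) (p 2) = 0 ∧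
      ∃ κ, qX c (p 0) (p 1) (p 2) = κ * d 0 ∧ qY c (p 0) (p 1) (p 2) = κ * d 1 ∧ qZ c (p 0) (p 1) (p 2) = κ * d 2 := by
  obtain ⟨hd, a, b, hab, hda, hdb, L, M, hL, hM, hL0, hLM⟩ := h
  obtain ⟨l, m, rfl⟩ := lin_form L hL
  obtain ⟨l', m', rfl⟩ := lin_form M hM
  have hn := cross_ne a b hab
  have hev : ∀ s t : k, qf c (s * a 0 + t * b 0) (s * a 1 + t * b 1) (s * a 2 + t * b 2)
      = (l * s + m * t) ^ 3 * (l' * s + m' * t) := by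
    intro s t
    have := congrArg (eval ![s, t]) hLM
    rw [restrictLine, aeval_Qp, map_qf] at this
    simp only [map_add, map_mul, map_pow, eval_C, eval_X, algebraMap_eq] at this
    simp only [Matrix.cons_val_zero, Matrix.cons_val_one] at this
    rw [← this]
    congr 1 <;> ring
  set p : Fin 3 → k := fun i => m * a i - l * b i with hp
  have hT : ∀ s t : k, qf c (p 0) (p 1) (p 2) = 0 ∧
      gdot c (p 0) (p 1) (p 2) (s * a 0 + t * b 0) (s * a 1 + t * b 1) (s * a 2 + t * b 2) = 0 ∧
      Wf c (p 0) (p 1) (p 2) (s * a 0 + t * b 0) (s * a 1 + t * b 1) (s * a 2 + t * b 2) = 0 := by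
    intro s t
    have key := quart_coeffs _ _ _ _ _ (fun ε => by
      have e1 := hev (m + ε * s) (-l + ε * t)
      have e2 := taylor c (p 0) (p 1) (p 2) (s * a 0 + t * b 0) (s * a 1 + t * b 1) (s * a 2 + t * b 2) 1 ε
      rw [show (1 : k) * p 0 + ε * (s * a 0 + t * b 0) = (m + ε * s) * a 0 + (-l + ε * t) * b 0 by simp only [hp]; ring,
        show (1 : k) * p 1 + ε * (s * a 1 + t * b 1) = (m + ε * s) * a 1 + (-l + ε * t) * b 1 by simp only [hp]; ring,
        show (1 : k) * p 2 + ε * (s * a 2 + t * b 2) = (m + ε * s) * a 2 + (-l + ε * t) * b 2 by simp only [hp]; ring,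
        e1] at e2
      show qf c (p 0) (p 1) (p 2) + ε * gdot c (p 0) (p 1) (p 2) (s * a 0 + t * b 0) (s * a 1 + t * b 1) (s * a 2 + t * b 2)
        + ε ^ 2 * Wf c (p 0) (p 1) (p 2) (s * a 0 + t * b 0) (s * a 1 + t * b 1) (s * a 2 + t * b 2)
        + ε ^ 3 * (gdot c (s * a 0 + t * b 0) (s * a 1 + t * b 1) (s * a 2 + t * b 2) (p 0) (p 1) (p 2)
            - (l * s + m * t) ^ 3 * (l' * m - m' * l))
        + ε ^ 4 * (qf c (s * a 0 + t * b 0) (s * a 1 + t * b 1) (s * a 2 + t * b 2) - (l * s + m * t) ^ 3 * (l' * s + m' * t)) = 0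
      linear_combination -e2)
    exact ⟨key.1, key.2.1, key.2.2.1⟩
  have hq := (hT 0 0).1
  have ga := (hT 1 0).2.1
  have gb := (hT 0 1).2.1
  have hW := fun s t => (hT s t).2.2
  have hp0 : p ≠ 0 := by
    intro h
    rw [LinearIndependent.pair_iff] at hab
    obtain ⟨hm, hl⟩ := hab m (-l) (by
      rw [← h]; ext i; simp [hp]; ring)
    apply hL0
    rw [hm, neg_eq_zero.mp hl]; simp
  simp only [gdot] at ga gb
  have prop : ∀ e : Fin 3 → k, e 0 * a 0 + e 1 * a 1 + e 2 * a 2 = 0 → e 0 * b 0 + e 1 * b 1 + e 2 * b 2 = 0 →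
      ∃ κ, e 0 = κ * (a 1 * b 2 - a 2 * b 1) ∧ e 1 = κ * (a 2 * b 0 - a 0 * b 2) ∧ e 2 = κ * (a 0 * b 1 - a 1 * b 0) := by
    intro e ha hb
    by_cases h0 : a 1 * b 2 - a 2 * b 1 = 0
    · by_cases h1 : a 2 * b 0 - a 0 * b 2 = 0
      · have h2 : a 0 * b 1 - a 1 * b 0 ≠ 0 := fun h2 => hn ⟨h0, h1, h2⟩
        refine ⟨e 2 / (a 0 * b 1 - a 1 * b 0), ?_, ?_, ?_⟩ <;> field_simp
        · linear_combination b 1 * ha - a 1 * hb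
        · linear_combination a 0 * hb - b 0 * ha
      · refine ⟨e 1 / (a 2 * b 0 - a 0 * b 2), ?_, ?_, ?_⟩ <;> field_simp
        · linear_combination a 2 * hb - b 2 * ha
        · linear_combination b 0 * ha - a 0 * hb
    · refine ⟨e 0 / (a 1 * b 2 - a 2 * b 1), ?_, ?_, ?_⟩ <;> field_simp
      · linear_combination b 2 * ha - a 2 * hb
      · linear_combination a 1 * hb - b 1 * ha
  obtain ⟨κ, k0, k1, k2⟩ := prop ![qX c (p 0) (p 1) (p 2), qY c (p 0) (p 1) (p 2), qZ c (p 0) (p 1) (p 2)]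
    (by simp; linear_combination ga) (by simp; linear_combination gb)
  obtain ⟨ρ, r0, r1, r2⟩ := prop d hda hdb
  simp only [Matrix.cons_val_zero, Matrix.cons_val_one] at k0 k1
  change qZ c (p 0) (p 1) (p 2) = _ at k2
  have hρ : ρ ≠ 0 := by
    rintro rfl
    apply hd
    ext i; fin_cases i
    · simpa using r0
    · simpa using r1
    · simpa using r2
  refine ⟨p, hp0, hq, ?_, κ / ρ, ?_, ?_, ?_⟩
  · have := hW (- κ * b 2) (κ * a 2)
    rw [← W_tau, k0, k1]
    convert this using 1
    congr 1 <;> ring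
  · rw [k0, r0]; field_simp
  · rw [k1, r1]; field_simp
  · rw [k2, r2]; field_simp

lemma flex_of_infl {c : Fin 15 → k} (hc : Good c)
    (h : {ℓ : Projectivization k (Fin 3 → k) | IsInflectionLine (Qp c) ℓ.rep}.Infinite) : Flex c := by
  by_contra hF
  have hnd : ¬ Qp c ∣ Q2 (cC c) (X 0) (X 1) (X 2) := by
    intro hd
    apply hF
    intro p hp
    have := dvd_van hd p hp
    rw [eval_Q2] at this
    simpa using this
  have hfin := finite_inter (Qp c) hc.prime (Q2 (cC c) (X 0) (X 1) (X 2)) hc.hom (fun p t hp => by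
    rw [eval_Q2] at hp ⊢
    simp only [eval_X, Pi.smul_apply, smul_eq_mul] at hp ⊢
    rw [Q2_smul, hp, mul_zero]) hnd
  have key : ∀ ℓ : Projectivization k (Fin 3 → k), IsInflectionLine (Qp c) ℓ.rep →
      ∃ m : Projectivization k (Fin 3 → k), eval m.rep (Qp c) = 0 ∧ eval m.rep (Q2 (cC c) (X 0) (X 1) (X 2)) = 0 ∧
       ∃ κ, qX c (m.rep 0) (m.rep 1) (m.rep 2) = κ * ℓ.rep 0 ∧ qY c (m.rep 0) (m.rep 1) (m.rep 2) = κ * ℓ.rep 1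
        ∧ qZ c (m.rep 0) (m.rep 1) (m.rep 2) = κ * ℓ.rep 2 := by
    intro ℓ hℓ
    obtain ⟨p, hp0, h1, h2, κ, k0, k1, k2⟩ := infl_point hc _ hℓ
    refine ⟨Projectivization.mk k p hp0, ?_⟩
    obtain ⟨a, ha⟩ := Projectivization.exists_smul_eq_mk_rep k p hp0
    have hr : ∀ i, (Projectivization.mk k p hp0).rep i = (a : k) * p i := by
      intro i; rw [← ha]; rfl
    rw [eval_Qp, eval_Q2]
    simp only [eval_X, hr, qf_smul, Q2_smul, qX_smul, qY_smul, qZ_smul, h1, h2, k0, k1, k2]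
    exact ⟨by ring, by ring, a ^ 3 * κ, by ring, by ring, by ring⟩
  choose! f hf using key
  have hinj : Set.InjOn f {ℓ : Projectivization k (Fin 3 → k) | IsInflectionLine (Qp c) ℓ.rep} := by
    intro ℓ hℓ ℓ' hℓ' he
    obtain ⟨a1, -, κ, k0, k1, k2⟩ := hf ℓ hℓ
    obtain ⟨-, -, κ', k0', k1', k2'⟩ := hf ℓ' hℓ'
    rw [eval_Qp] at a1
    rw [← he] at k0' k1' k2'
    have hκ : κ ≠ 0 := by
      rintro rfl
      obtain ⟨z0, z1, z2⟩ := hc.sm _ _ _ a1 (by rw [k0, zero_mul]) (by rw [k1, zero_mul]) (by rw [k2, zero_mul])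
      apply (f ℓ).rep_nonzero
      ext i; fin_cases i <;> assumption
    rw [← ℓ.mk_rep, ← ℓ'.mk_rep, Projectivization.mk_eq_mk_iff']
    refine ⟨κ' / κ, ?_⟩
    ext i
    simp only [Pi.smul_apply, smul_eq_mul]
    fin_cases i <;> simp <;> field_simp
    · rw [← k0', k0]
    · rw [← k1', k1]
    · rw [← k2', k2]
  refine Set.infinite_of_injOn_mapsTo hinj (fun ℓ hℓ => ?_) h hfin
  exact ⟨(hf ℓ hℓ).1, (hf ℓ hℓ).2.1⟩

end

section
lemma single_add_eq {a b a' b' : ℕ} :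
    (Finsupp.single (0 : Fin 2) a + Finsupp.single 1 b = Finsupp.single 0 a' + Finsupp.single 1 b') ↔ a = a' ∧ b = b' := by
  constructor
  · intro h
    have h0 := DFunLike.congr_fun h 0
    have h1 := DFunLike.congr_fun h 1
    simp at h0 h1
    exact ⟨h0, h1⟩
  · rintro ⟨rfl, rfl⟩; rfl

lemma coeff_bin {R : Type*} [CommRing R] (r : R) (a b a' b' : ℕ) :
    coeff (Finsupp.single (0 : Fin 2) a' + Finsupp.single 1 b') (C r * X 0 ^ a * X 1 ^ b)
      = if a = a' ∧ b = b' then r else 0 := by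
  have : (C r * X 0 ^ a * X 1 ^ b : MvPolynomial (Fin 2) R) = monomial (Finsupp.single 0 a + Finsupp.single 1 b) r := by
    rw [monomial_eq, Finsupp.prod_fintype _ _ (by simp), Fin.prod_univ_two]
    simp [mul_assoc]
  rw [this, coeff_monomial]
  simp only [single_add_eq]

lemma binCoeff_expl {R : Type*} [CommRing R] (f0 f1 f2 f3 f4 : R) (g : MvPolynomial (Fin 2) R)
    (hg : g = C f0 * X 0 ^ 4 * X 1 ^ 0 + C f1 * X 0 ^ 3 * X 1 ^ 1 + C f2 * X 0 ^ 2 * X 1 ^ 2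
      + C f3 * X 0 ^ 1 * X 1 ^ 3 + C f4 * X 0 ^ 0 * X 1 ^ 4) :
    binCoeff g 0 = f0 ∧ binCoeff g 1 = f1 ∧ binCoeff g 2 = f2 ∧ binCoeff g 3 = f3 ∧ binCoeff g 4 = f4 := by
  subst hg
  refine ⟨?_, ?_, ?_, ?_, ?_⟩ <;> simp only [binCoeff, coeff_add, coeff_bin] <;> norm_num

variable {k : Type*} [Field k]

lemma gsub_Qp (c : Fin 15 → k) : gsub (Qp c) =
    C (qf (cC c) (- X 1) (X 0) 0) * X 0 ^ 4 * X 1 ^ 0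
    + C (gdot (cC c) (- X 1) (X 0) 0 (- X 2) 0 (X 0)) * X 0 ^ 3 * X 1 ^ 1
    + C (Wf (cC c) (- X 1) (X 0) 0 (- X 2) 0 (X 0)) * X 0 ^ 2 * X 1 ^ 2
    + C (gdot (cC c) (- X 2) 0 (X 0) (- X 1) (X 0) 0) * X 0 ^ 1 * X 1 ^ 3
    + C (qf (cC c) (- X 2) 0 (X 0)) * X 0 ^ 0 * X 1 ^ 4 := by
  have h := taylor (fun i => (C (C (c i)) : MvPolynomial (Fin 2) (MvPolynomial (Fin 3) k)))
    (C (- X 1)) (C (X 0)) 0 (C (- X 2)) 0 (C (X 0)) (X 0) (X 1)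
  rw [gsub, aeval_Qp]
  have e : (fun i => algebraMap k (MvPolynomial (Fin 2) (MvPolynomial (Fin 3) k)) (c i)) = fun i => C (C (c i)) := by
    ext1 i; rfl
  rw [e]
  simp only [Matrix.cons_val_zero, Matrix.cons_val_one, Matrix.cons_val]
  rw [show (C (-X 1) * X 0 - C (X 2) * X 1 : MvPolynomial (Fin 2) (MvPolynomial (Fin 3) k))
      = X 0 * C (- X 1) + X 1 * C (- X 2) by simp only [C_neg]; ring,
    show (C (X 0) * X 0 : MvPolynomial (Fin 2) (MvPolynomial (Fin 3) k))
      = X 0 * C (X 0) + X 1 * 0 by ring,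
    show (C (X 0) * X 1 : MvPolynomial (Fin 2) (MvPolynomial (Fin 3) k))
      = X 0 * 0 + X 1 * C (X 0) by ring, h]
  have e1 : (C (qf (cC c) (- X 1) (X 0) 0) : MvPolynomial (Fin 2) (MvPolynomial (Fin 3) k)) = 
     qf (fun i => C (C (c i))) (C (- X 1)) (C (X 0)) 0 := by
    simp only [qf, cC, map_add, map_mul, map_pow, map_neg, map_zero, map_ofNat]
  have e2 : (C (qf (cC c) (- X 2) 0 (X 0)) : MvPolynomial (Fin 2) (MvPolynomial (Fin 3) k)) = 
     qf (fun i => C (C (c i))) (C (- X 2)) 0 (C (X 0)) := by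
    simp only [qf, cC, map_add, map_mul, map_pow, map_neg, map_zero, map_ofNat]
  have e3 : (C (gdot (cC c) (- X 1) (X 0) 0 (- X 2) 0 (X 0)) : MvPolynomial (Fin 2) (MvPolynomial (Fin 3) k)) = 
     gdot (fun i => C (C (c i))) (C (- X 1)) (C (X 0)) 0 (C (- X 2)) 0 (C (X 0)) := by
    simp only [gdot, qX, qY, qZ, cC, map_add, map_mul, map_pow, map_neg, map_zero, map_ofNat]
  have e4 : (C (gdot (cC c) (- X 2) 0 (X 0) (- X 1) (X 0) 0) : MvPolynomial (Fin 2) (MvPolynomial (Fin 3) k)) = 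
     gdot (fun i => C (C (c i))) (C (- X 2)) 0 (C (X 0)) (C (- X 1)) (C (X 0)) 0 := by
    simp only [gdot, qX, qY, qZ, cC, map_add, map_mul, map_pow, map_neg, map_zero, map_ofNat]
  have e5 : (C (Wf (cC c) (- X 1) (X 0) 0 (- X 2) 0 (X 0)) : MvPolynomial (Fin 2) (MvPolynomial (Fin 3) k)) = 
     Wf (fun i => C (C (c i))) (C (- X 1)) (C (X 0)) 0 (C (- X 2)) 0 (C (X 0)) := by
    simp only [Wf, hXX, hYY, hZZ, qXY, qXZ, qYZ, cC, map_add, map_mul, map_pow, map_neg, map_zero, map_ofNat]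
  rw [e1, e2, e3, e4, e5]
  ring

lemma SG_Qp (c : Fin 15 → k) (h : SG (Qp c) = 0) (u v w : k) :
    12 * qf c (-v) u 0 * qf c (-w) 0 u - 3 * gdot c (-v) u 0 (-w) 0 u * gdot c (-w) 0 u (-v) u 0
      + Wf c (-v) u 0 (-w) 0 u ^ 2 = 0 := by
  obtain ⟨h0, h1, h2, h3, h4⟩ := binCoeff_expl _ _ _ _ _ _ (gsub_Qp c)
  rw [SG, Sinv, h0, h1, h2, h3, h4] at h
  have := congrArg (eval ![u, v, w]) h
  simpa [gdot, Wf, eval_qf, eval_qX, eval_qY, eval_qZ, eval_hXX, eval_hYY, eval_hZZ, eval_qXY, eval_qXZ, eval_qYZ] using this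

variable [IsAlgClosed k]

lemma pd_qX2 (c : Fin 15 → k) : pderiv 2 (qX (cC c) (X 0) (X 1) (X 2)) = qXZ (cC c) (X 0) (X 1) (X 2) := by
  simp only [qX, qXZ, cC, map_add, Derivation.leibniz, Derivation.leibniz_pow, pderiv_C, pderiv_X_self, pd20, pd21, pdn2, pdn3, pdn4, pdn6,
    smul_eq_mul, nsmul_eq_mul, smul_zero]
  push_cast; ring

lemma qX_ne {c : Fin 15 → k} (hc : Good c) (h : qX (cC c) (X 0) (X 1) (X 2) = 0) : False := by
  have hX : ∀ p : Fin 3 → k, qX c (p 0) (p 1) (p 2) = 0 := fun p => by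
    have := congrArg (eval p) h
    rw [eval_qX] at this; simpa using this
  by_cases h2 : (2 : k) = 0
  · have hXY : ∀ p : Fin 3 → k, qXY c (p 0) (p 1) (p 2) = 0 := fun p => by
      have := congrArg (fun f => eval p (pderiv 1 f)) h
      simp only [pd_qX1, eval_qXY] at this; simpa using this
    have hXZ : ∀ p : Fin 3 → k, qXZ c (p 0) (p 1) (p 2) = 0 := fun p => by
      have := congrArg (fun f => eval p (pderiv 2 f)) h
      simp only [pd_qX2, eval_qXZ] at this; simpa using this
    obtain ⟨p, hp0, hp, hq⟩ := bezout_aux (Qp c) (qYZ (cC c) (X 0) (X 1) (X 2)) (by rw [eval_Qp]; simp [qf])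
      (by rw [eval_qYZ]; simp [qYZ])
    rw [eval_Qp] at hp
    rw [eval_qYZ] at hq
    simp only [eval_X] at hq
    have eY := eulY c (p 0) (p 1) (p 2)
    have eZ := eulZ c (p 0) (p 1) (p 2)
    rw [hXY, hq] at eY
    rw [hXZ, hq] at eZ
    obtain ⟨a, b, d⟩ := hc.sm _ _ _ hp (hX p) (by linear_combination eY + (p 1 * hYY c (p 0) (p 1) (p 2) - qY c (p 0) (p 1) (p 2)) * h2)
       (by linear_combination eZ + (p 2 * hZZ c (p 0) (p 1) (p 2) - qZ c (p 0) (p 1) (p 2)) * h2)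
    apply hp0
    ext i; fin_cases i <;> assumption
  · obtain ⟨p, hp0, hp, hq⟩ := bezout_aux (qY (cC c) (X 0) (X 1) (X 2)) (qZ (cC c) (X 0) (X 1) (X 2)) (by rw [eval_qY]; simp [qY])
      (by rw [eval_qZ]; simp [qZ])
    rw [eval_qY] at hp
    rw [eval_qZ] at hq
    simp only [eval_X] at hp hq
    have e := euler c (p 0) (p 1) (p 2)
    simp only [gdot, hp, hq, hX p] at e
    have q0 : qf c (p 0) (p 1) (p 2) = 0 := by
      have : (2 : k) * 2 ≠ 0 := mul_ne_zero h2 h2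
      apply mul_left_cancel₀ this
      linear_combination -e
    obtain ⟨a, b, d⟩ := hc.sm _ _ _ q0 (hX p) hp hq
    apply hp0
    ext i; fin_cases i <;> assumption

lemma flex_of_SG {c : Fin 15 → k} (hc : Good c) (h : SG (Qp c) = 0) : Flex c := by
  have key : ∀ p : Fin 3 → k, qf c (p 0) (p 1) (p 2) = 0 → qX c (p 0) (p 1) (p 2) * Q2 c (p 0) (p 1) (p 2) = 0 := by
    intro p hp
    have hS := SG_Qp c h (qX c (p 0) (p 1) (p 2)) (qY c (p 0) (p 1) (p 2)) (qZ c (p 0) (p 1) (p 2))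
    have eu := euler c (p 0) (p 1) (p 2)
    rw [hp] at eu
    simp only [gdot] at eu
    have hW : Wf c (p 0) (p 1) (p 2) (- qY c (p 0) (p 1) (p 2)) (qX c (p 0) (p 1) (p 2)) 0 = Q2 c (p 0) (p 1) (p 2) := by
      simp only [Wf, Q2]; ring
    have hg : gdot c (p 0) (p 1) (p 2) (- qY c (p 0) (p 1) (p 2)) (qX c (p 0) (p 1) (p 2)) 0 = 0 := by
      simp only [gdot]; ring
    generalize qX c (p 0) (p 1) (p 2) = u at *
    generalize qY c (p 0) (p 1) (p 2) = v at *
    generalize qZ c (p 0) (p 1) (p 2) = w at *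
    generalize Q2 c (p 0) (p 1) (p 2) = Q at *
    have e := fun t : k => taylor c (-v) u 0 (-w) 0 u (p 1 + t) (p 2)
    have e' := fun t : k => taylor c (p 0) (p 1) (p 2) (-v) u 0 u t
    have hc' := quart_coeffs
      (qf c (-v) u 0 * p 1 ^ 4 + gdot c (-v) u 0 (-w) 0 u * p 1 ^ 3 * p 2 + Wf c (-v) u 0 (-w) 0 u * p 1 ^ 2 * p 2 ^ 2
        + gdot c (-w) 0 u (-v) u 0 * p 1 * p 2 ^ 3 + qf c (-w) 0 u * p 2 ^ 4)
      (4 * qf c (-v) u 0 * p 1 ^ 3 + 3 * gdot c (-v) u 0 (-w) 0 u * p 1 ^ 2 * p 2 + 2 * Wf c (-v) u 0 (-w) 0 u * p 1 * p 2 ^ 2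
        + gdot c (-w) 0 u (-v) u 0 * p 2 ^ 3)
      (6 * qf c (-v) u 0 * p 1 ^ 2 + 3 * gdot c (-v) u 0 (-w) 0 u * p 1 * p 2 + Wf c (-v) u 0 (-w) 0 u * p 2 ^ 2 - u ^ 2 * Q)
      (4 * qf c (-v) u 0 * p 1 + gdot c (-v) u 0 (-w) 0 u * p 2 - u * gdot c (-v) u 0 (p 0) (p 1) (p 2)) 0 (fun t => by
        have a := e t
        have b := e' t
        rw [hp, hg, hW] at b
        rw [show (p 1 + t) * -v + p 2 * -w = u * p 0 + t * -v by linear_combination -eu,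
          show (p 1 + t) * u + p 2 * 0 = u * p 1 + t * u by ring,
          show (p 1 + t) * 0 + p 2 * u = u * p 2 + t * 0 by ring, b] at a
        linear_combination -a)
    obtain ⟨a0, a1, a2, -, -⟩ := hc'
    generalize qf c (-v) u 0 = f0 at *
    generalize gdot c (-v) u 0 (-w) 0 u = f1 at *
    generalize Wf c (-v) u 0 (-w) 0 u = f2 at *
    generalize gdot c (-w) 0 u (-v) u 0 = f3 at *
    generalize qf c (-w) 0 u = f4 at *
    have fin : (u ^ 2 * Q) ^ 2 = 0 := by
      rw [← sub_eq_zero.mp a2]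
      linear_combination (p 2) ^ 4 * hS - 12 * f0 * a0 + 3 * (4 * f0 * p 1 + f1 * p 2) * a1
    have := pow_eq_zero_iff (two_ne_zero) |>.mp fin
    rcases mul_eq_zero.mp this with h | h
    · rw [pow_eq_zero_iff two_ne_zero |>.mp h, zero_mul]
    · rw [h, mul_zero]
  rcases van_mul hc (qX (cC c) (X 0) (X 1) (X 2)) (Q2 (cC c) (X 0) (X 1) (X 2)) (fun p hp => by
    rw [eval_qX, eval_Q2]; simpa using key p hp) with h1 | h1
  · exfalso
    rw [← pd_qf0] at h1
    have := van_low_hom hc _ (by norm_num) hc.hom.pderiv h1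
    rw [pd_qf0] at this
    exact qX_ne hc this
  · intro p hp
    have := h1 p hp
    rw [eval_Q2] at this; simpa using this

end

section
variable {k : Type*} [Field k]

/-- auxiliary sequence for Lang's theorem -/
def langP (a : ℕ → k) (Q : ℕ) (t : k) : ℕ → k
  | 0 => a 0 * t ^ Q
  | (n+1) => (langP a Q t n) ^ Q + a (n+1) * t ^ Q

/-- auxiliary polynomials for Lang's theorem -/
def langR (a : ℕ → k) (Q : ℕ) : ℕ → Polynomial k
  | 0 => Polynomial.C (a 0)
  | (n+1) => (langR a Q n) ^ Q * Polynomial.X ^ (Q * (Q - 1)) + Polynomial.C (a (n+1))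

lemma langPR (a : ℕ → k) (Q : ℕ) (hQ : 2 ≤ Q) (t : k) (n : ℕ) :
    langP a Q t n = t ^ Q * (langR a Q n).eval t := by
  induction n with
  | zero => simp [langP, langR, mul_comm]
  | succ n ih =>
    obtain ⟨r, rfl⟩ : ∃ r, Q = r + 1 := ⟨Q - 1, by omega⟩
    simp only [langP, langR, ih, Polynomial.eval_add, Polynomial.eval_mul, Polynomial.eval_pow, Polynomial.eval_X, Polynomial.eval_C,
      Nat.add_sub_cancel]
    ring

lemma langR_ne (a : ℕ → k) (Q : ℕ) (hQ : 2 ≤ Q) (n : ℕ) (h : ∃ i ≤ n, a i ≠ 0) : langR a Q n ≠ 0 := by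
  induction n with
  | zero =>
    obtain ⟨i, hi, h⟩ := h
    obtain rfl : i = 0 := by omega
    simpa [langR] using h
  | succ n ih =>
    have hpos : Q * (Q - 1) ≠ 0 := Nat.mul_ne_zero (by omega) (by omega)
    by_cases h0 : a (n+1) = 0
    · obtain ⟨i, hi, h⟩ := h
      have : i ≤ n := by
        by_contra hh
        obtain rfl : i = n + 1 := by omega
        exact h h0
      have := ih ⟨i, this, h⟩
      simp only [langR, h0, map_zero, add_zero]
      exact mul_ne_zero (pow_ne_zero _ this) (pow_ne_zero _ Polynomial.X_ne_zero)
    · intro hz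
      have := congrArg (Polynomial.eval 0) hz
      simp [langR, hpos] at this
      exact h0 this

variable [IsAlgClosed k]

lemma langP_exists (a : ℕ → k) (Q : ℕ) (hQ : 2 ≤ Q) (n : ℕ) (h : ∃ i ≤ n, a i ≠ 0) :
    ∃ t ≠ 0, langP a Q t n = t := by
  have hR := langR_ne a Q hQ n h
  have hdeg : (Polynomial.X ^ (Q - 1) * langR a Q n - 1).degree ≠ 0 := by
    intro hd
    have := Polynomial.eq_C_of_degree_eq_zero hd
    set c := (Polynomial.X ^ (Q - 1) * langR a Q n - 1).coeff 0
    have e : Polynomial.X ^ (Q - 1) * langR a Q n = Polynomial.C (c + 1) := by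
      rw [map_add, ← this]; simp
    have h0 := congrArg (Polynomial.eval 0) e
    have : Q - 1 ≠ 0 := by omega
    simp [this] at h0
    rw [← h0] at e
    simp at e
    exact hR e
  obtain ⟨t, ht⟩ := IsAlgClosed.exists_root _ hdeg
  have ht' : t ^ (Q - 1) * (langR a Q n).eval t = 1 := by
    have : t ^ (Q - 1) * (langR a Q n).eval t - 1 = 0 := by simpa [Polynomial.IsRoot] using ht
    linear_combination this
  refine ⟨t, ?_, ?_⟩
  · rintro rfl
    have : Q - 1 ≠ 0 := by omega
    simp [this] at ht'
  · rw [langPR a Q hQ]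
    obtain ⟨r, rfl⟩ : ∃ r, Q = r + 1 := ⟨Q - 1, by omega⟩
    simp only [Nat.add_sub_cancel] at ht'
    linear_combination t * ht'

lemma artin_schreier (Q : ℕ) (hQ : 2 ≤ Q) (c : k) : ∃ x : k, x ^ Q - x = c := by
  have hd : (Polynomial.X ^ Q - (Polynomial.X + Polynomial.C c) : Polynomial k).degree = (Q : WithBot ℕ) := by
    rw [Polynomial.degree_sub_eq_left_of_degree_lt]
    · simp
    · rw [Polynomial.degree_X_add_C, Polynomial.degree_X_pow]
      exact_mod_cast hQ
  obtain ⟨t, ht⟩ := IsAlgClosed.exists_root _ (show (Polynomial.X ^ Q - (Polynomial.X + Polynomial.C c) : Polynomial k).degree ≠ 0 by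
    rw [hd]; exact_mod_cast (by omega : Q ≠ 0))
  refine ⟨t, ?_⟩
  simp [Polynomial.IsRoot] at ht
  linear_combination ht

lemma lang_one {V : Type*} [AddCommGroup V] [Module k V] [FiniteDimensional k V] [Nontrivial V]
    (σ : k →+* k) (Q : ℕ) (hQ : 2 ≤ Q) (hσ : ∀ x, σ x = x ^ Q) (F : V →ₛₗ[σ] V)
    (hF : Function.Injective F) : ∃ v, v ≠ 0 ∧ F v = v := by
  classical
  obtain ⟨v, hv⟩ := exists_ne (0 : V)
  have hit : ∀ n, F^[n] v ≠ 0 := by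
    intro n
    induction n with
    | zero => simpa
    | succ n ih =>
      rw [Function.iterate_succ_apply']
      intro h
      exact ih (hF (h.trans (map_zero F).symm))
  have hex : ∃ n, F^[n] v ∈ Submodule.span k (Set.range (fun i : Fin n => F^[i] v)) := by
    by_contra hcon
    push Not at hcon
    have hli : ∀ n, LinearIndependent k (fun i : Fin n => F^[i] v) := by
      intro n
      induction n with
      | zero => exact linearIndependent_empty_type
      | succ n ih =>
        rw [linearIndependent_fin_succ']
        refine ⟨?_, ?_⟩
        · exact ih
        · exact hcon n
    have := (hli (Module.finrank k V + 1)).fintype_card_le_finrank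
    simp at this
  have hn := Nat.find_spec hex
  have hmin := fun m => Nat.find_min hex (m := m)
  generalize Nat.find hex = n at hn hmin
  obtain ⟨m, rfl⟩ : ∃ m, n = m + 1 := by
    rcases n with _ | m
    · exfalso
      simp at hn
      exact hv hn
    · exact ⟨m, rfl⟩
  rw [Submodule.mem_span_range_iff_exists_fun] at hn
  obtain ⟨a', ha'⟩ := hn
  set a : ℕ → k := fun i => if h : i < m + 1 then a' ⟨i, h⟩ else 0 with ha
  have hs : ∑ i ∈ Finset.range (m+1), a i • F^[i] v = F^[m+1] v := by
    rw [Finset.sum_range, ← ha']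
    apply Finset.sum_congr rfl
    intro i _
    simp only [ha, i.2, dif_pos]
  have hne : ∃ i ≤ m, a i ≠ 0 := by
    by_contra hcon
    push Not at hcon
    apply hit (m+1)
    rw [← hs]
    apply Finset.sum_eq_zero
    intro i hi
    rw [hcon i (by simp at hi; omega), zero_smul]
  obtain ⟨t, ht0, ht⟩ := langP_exists a Q hQ m hne
  refine ⟨∑ i ∈ Finset.range (m+1), langP a Q t i • F^[i] v, ?_, ?_⟩
  · intro h0
    rw [Finset.sum_range_succ, ht] at h0
    apply hmin m (by omega)
    have : F^[m] v = t⁻¹ • (- ∑ i ∈ Finset.range m, langP a Q t i • F^[i] v) := by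
      rw [← eq_neg_iff_add_eq_zero.mpr ((add_comm _ _).trans h0), smul_smul, inv_mul_cancel₀ ht0, one_smul]
    rw [this]
    apply Submodule.smul_mem
    apply Submodule.neg_mem
    apply Submodule.sum_mem
    intro i hi
    apply Submodule.smul_mem
    exact Submodule.subset_span ⟨⟨i, by simpa using hi⟩, rfl⟩
  · rw [map_sum]
    simp only [map_smulₛₗ, hσ, ← Function.iterate_succ_apply' (f := F)]
    rw [Finset.sum_range_succ, ht, ← hs, Finset.sum_range_succ' (fun i => langP a Q t i • F^[i] v),
      Finset.sum_range_succ' (fun i => a i • F^[i] v), smul_add, ← add_assoc, Finset.smul_sum, ← Finset.sum_add_distrib]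
    congr 1
    · apply Finset.sum_congr rfl
      intro i _
      rw [langP, smul_smul, ← add_smul, mul_comm (t ^ Q)]
    · rw [langP, smul_smul, mul_comm (t ^ Q)]

lemma lang_span {V : Type*} [AddCommGroup V] [Module k V] [FiniteDimensional k V]
    (σ : k →+* k) (Q : ℕ) (hQ : 2 ≤ Q) (hσ : ∀ x, σ x = x ^ Q) (F : V →ₛₗ[σ] V)
    (hF : Function.Injective F) : Submodule.span k {v | F v = v} = ⊤ := by
  classical
  set W := Submodule.span k {v | F v = v} with hW
  have hsurj : ∀ w ∈ W, ∀ c : k, ∃ x ∈ W, F x = c • w := by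
    intro w hw
    induction hw using Submodule.span_induction with
    | mem x h =>
      intro c
      obtain ⟨y, hy⟩ := IsAlgClosed.exists_pow_nat_eq c (show 0 < Q by omega)
      exact ⟨y • x, W.smul_mem _ (Submodule.subset_span h), by rw [map_smulₛₗ, hσ, hy, show F x = x from h]⟩
    | zero => exact fun c => ⟨0, W.zero_mem, by simp⟩
    | add x y hx hy ihx ihy =>
      intro c
      obtain ⟨a, ha, ha'⟩ := ihx c
      obtain ⟨b, hb, hb'⟩ := ihy c
      exact ⟨a + b, W.add_mem ha hb, by rw [map_add, ha', hb', smul_add]⟩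
    | smul d x hx ihx =>
      intro c
      rw [smul_smul]
      exact ihx _
  have hAS : ∀ w ∈ W, ∀ c : k, ∃ x ∈ W, F x - x = c • w := by
    intro w hw
    induction hw using Submodule.span_induction with
    | mem x h =>
      intro c
      obtain ⟨y, hy⟩ := artin_schreier Q hQ c
      exact ⟨y • x, W.smul_mem _ (Submodule.subset_span h), by rw [map_smulₛₗ, hσ, show F x = x from h, ← sub_smul, hy]⟩
    | zero => exact fun c => ⟨0, W.zero_mem, by simp⟩
    | add x y hx hy ihx ihy =>
      intro c
      obtain ⟨a, ha, ha'⟩ := ihx c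
      obtain ⟨b, hb, hb'⟩ := ihy c
      exact ⟨a + b, W.add_mem ha hb, by rw [map_add, smul_add, ← ha', ← hb']; abel⟩
    | smul d x hx ihx =>
      intro c
      rw [smul_smul]
      exact ihx _
  have hle : W ≤ W.comap F := by
    rw [hW, Submodule.span_le]
    intro x hx
    have : F x = x := hx
    show F x ∈ W
    rw [this]
    exact Submodule.subset_span hx
  by_contra hne
  have : Nontrivial (V ⧸ W) := Submodule.Quotient.nontrivial_iff.mpr hne
  obtain ⟨vb, hvb, hfix⟩ := lang_one σ Q hQ hσ (W.mapQ W F hle) (by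
    rw [injective_iff_map_eq_zero]
    intro a ha
    obtain ⟨v, rfl⟩ := W.mkQ_surjective a
    simp only [Submodule.mkQ_apply, Submodule.mapQ_apply, Submodule.Quotient.mk_eq_zero] at ha ⊢
    obtain ⟨x, hx, hx'⟩ := hsurj _ ha 1
    rw [one_smul] at hx'
    rw [← hF hx']; exact hx)
  obtain ⟨v, rfl⟩ := W.mkQ_surjective vb
  simp only [Submodule.mkQ_apply, Submodule.mapQ_apply, ne_eq, Submodule.Quotient.mk_eq_zero] at hvb hfix
  rw [Submodule.Quotient.eq] at hfix
  obtain ⟨x, hx, hx'⟩ := hAS _ hfix (-1)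
  apply hvb
  have : v + x ∈ W := by
    apply Submodule.subset_span
    show F (v + x) = v + x
    rw [map_add]
    rw [sub_eq_iff_eq_add] at hx'
    rw [hx', neg_one_smul]
    abel
  simpa using W.sub_mem this hx

end

section
variable {k : Type*} [Field k]

/-- the ternary quadratic form attached to the six mixed coefficients -/
def Gf {R : Type*} [CommRing R] (c : Fin 15 → R) (u v w : R) : R :=
  c 12 * u ^ 2 + c 5 * v ^ 2 + c 3 * w ^ 2 + 2 * c 4 * v * w + 2 * c 7 * u * w + 2 * c 8 * u * v

lemma eval_Gf (c : Fin 15 → k) (p : Fin 3 → k) (f g h : MvPolynomial (Fin 3) k) :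
    eval p (Gf (cC c) f g h) = Gf c (eval p f) (eval p g) (eval p h) := by simp [Gf, cC]

lemma W_eq_G (h3 : (3 : k) = 0) (c : Fin 15 → k) (x y z u v w : k) :
    Wf c x y z u v w = Gf c (y * w - z * v) (z * u - x * w) (x * v - y * u) := by
  simp only [Wf, Gf, hXX, hYY, hZZ, qXY, qXZ, qYZ]
  linear_combination ((2)*c 0*u^2*x^2 + (1)*c 1*u*v*x^2 + (1)*c 1*u^2*x*y + (1)*c 2*u*w*x^2 + (1)*c 2*u^2*x*z + (2)*c 3*u*v*x*y + (1)*c 4*v*w*x^2 + (1)*c 4*u^2*y*z + (2)*c 5*u*w*x*z + (1)*c 6*v^2*x*y + (1)*c 6*u*v*y^2 + (1)*c 7*v^2*x*z + (1)*c 7*u*w*y^2 + (1)*c 8*w^2*x*y + (1)*c 8*u*v*z^2 + (1)*c 9*w^2*x*z + (1)*c 9*u*w*z^2 + (2)*c 10*v^2*y^2 + (1)*c 11*v*w*y^2 + (1)*c 11*v^2*y*z + (2)*c 12*v*w*y*z + (1)*c 13*w^2*y*z + (1)*c 13*v*w*z^2 + (2)*c 14*w^2*z^2) * h3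

lemma binary_factor [IsAlgClosed k] (a b d : k) : ∃ l1 m1 l2 m2 : k, ∀ s t : k,
    a * s ^ 2 + b * s * t + d * t ^ 2 = (l1 * s + m1 * t) * (l2 * s + m2 * t) := by
  by_cases ha : a = 0
  · exact ⟨0, 1, b, d, fun s t => by rw [ha]; ring⟩
  · obtain ⟨r, hr⟩ := IsAlgClosed.exists_root (Polynomial.C a * Polynomial.X ^ 2 + Polynomial.C b * Polynomial.X + Polynomial.C d)
      (by rw [Polynomial.degree_quadratic ha]; norm_num)
    have hr' : a * r ^ 2 + b * r + d = 0 := by simpa [Polynomial.IsRoot] using hr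
    exact ⟨1, -r, a, a * r + b, fun s t => by linear_combination t ^ 2 * hr'⟩

/-- a degenerate form is a product of linear forms -/
lemma Gf_factor [IsAlgClosed k] (h3 : (3 : k) = 0) (c : Fin 15 → k) (n : Fin 3 → k) (hn : n ≠ 0)
    (h0 : c 12 * n 0 + c 8 * n 1 + c 7 * n 2 = 0)
    (h1 : c 8 * n 0 + c 5 * n 1 + c 4 * n 2 = 0)
    (h2 : c 7 * n 0 + c 4 * n 1 + c 3 * n 2 = 0) :
    ∃ l m : Fin 3 → k, ∀ u v w : k, Gf c u v w = (l 0 * u + l 1 * v + l 2 * w) * (m 0 * u + m 1 * v + m 2 * w) := by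
  have key : ∀ (u v w r : k), Gf c u v w = Gf c (u - r * n 0) (v - r * n 1) (w - r * n 2) := by
    intro u v w r
    simp only [Gf]
    linear_combination (2 * r * u - r ^ 2 * n 0) * h0 + (2 * r * v - r ^ 2 * n 1) * h1 + (2 * r * w - r ^ 2 * n 2) * h2
  by_cases hn0 : n 0 = 0
  · by_cases hn1 : n 1 = 0
    · have hn2 : n 2 ≠ 0 := fun hn2 => hn (by ext i; fin_cases i <;> assumption)
      obtain ⟨l1, m1, l2, m2, hf⟩ := binary_factor (c 12) (2 * c 8) (c 5)
      refine ⟨![l1, m1, -(l1 * n 0 + m1 * n 1) / n 2], ![l2, m2, -(l2 * n 0 + m2 * n 1) / n 2], fun u v w => ?_⟩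
      have e := hf (u - w / n 2 * n 0) (v - w / n 2 * n 1)
      rw [key u v w (w / n 2), div_mul_cancel₀ w hn2, sub_self]
      simp only [Gf, Matrix.cons_val_zero, Matrix.cons_val_one, Matrix.cons_val]
      calc _ = _ := by ring
        _ = _ := e
        _ = _ := by ring
    · obtain ⟨l1, m1, l2, m2, hf⟩ := binary_factor (c 12) (2 * c 7) (c 3)
      refine ⟨![l1, -(l1 * n 0 + m1 * n 2) / n 1, m1], ![l2, -(l2 * n 0 + m2 * n 2) / n 1, m2], fun u v w => ?_⟩
      have e := hf (u - v / n 1 * n 0) (w - v / n 1 * n 2)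
      rw [key u v w (v / n 1), div_mul_cancel₀ v hn1, sub_self]
      simp only [Gf, Matrix.cons_val_zero, Matrix.cons_val_one, Matrix.cons_val]
      calc _ = _ := by ring
        _ = _ := e
        _ = _ := by ring
  · obtain ⟨l1, m1, l2, m2, hf⟩ := binary_factor (c 5) (2 * c 4) (c 3)
    refine ⟨![-(l1 * n 1 + m1 * n 2) / n 0, l1, m1], ![-(l2 * n 1 + m2 * n 2) / n 0, l2, m2], fun u v w => ?_⟩
    have e := hf (v - u / n 0 * n 1) (w - u / n 0 * n 2)
    rw [key u v w (u / n 0), div_mul_cancel₀ u hn0, sub_self]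
    simp only [Gf, Matrix.cons_val_zero, Matrix.cons_val_one, Matrix.cons_val]
    calc _ = _ := by ring
      _ = _ := e
      _ = _ := by ring

/-- vanishing of the quadratic form -/
lemma Gf_zero (h3 : (3 : k) = 0) (c : Fin 15 → k) (h : ∀ u v w : k, Gf c u v w = 0) :
    c 3 = 0 ∧ c 4 = 0 ∧ c 5 = 0 ∧ c 7 = 0 ∧ c 8 = 0 ∧ c 12 = 0 := by
  have a := h 1 0 0
  have b := h 0 1 0
  have d := h 0 0 1
  have e := h 1 1 0
  have f := h 1 0 1
  have g := h 0 1 1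
  simp only [Gf] at a b d e f g
  refine ⟨?_, ?_, ?_, ?_, ?_, ?_⟩
  · linear_combination d
  · linear_combination c 4 * h3 - g + b + d
  · linear_combination b
  · linear_combination c 7 * h3 - f + a + d
  · linear_combination c 8 * h3 - e + a + b
  · linear_combination a

variable [IsAlgClosed k]

lemma Gg_van (h3 : (3 : k) = 0) {c : Fin 15 → k} (hc : Good c) (hF : Flex c) (p : Fin 3 → k)
    (hp : qf c (p 0) (p 1) (p 2) = 0) :
    Gf c (qX c (p 0) (p 1) (p 2)) (qY c (p 0) (p 1) (p 2)) (qZ c (p 0) (p 1) (p 2)) = 0 := by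
  have := zmul_van hc (Gf (cC c) (qX (cC c) (X 0) (X 1) (X 2)) (qY (cC c) (X 0) (X 1) (X 2)) (qZ (cC c) (X 0) (X 1) (X 2))) 2
    (fun p hp => by
      rw [eval_Gf, eval_qX, eval_qY, eval_qZ]
      simp only [eval_X]
      have hW : Wf c (p 0) (p 1) (p 2) (- qY c (p 0) (p 1) (p 2)) (qX c (p 0) (p 1) (p 2)) 0 = Q2 c (p 0) (p 1) (p 2) := by
        simp only [Wf, Q2]; ring
      rw [hF p hp, W_eq_G h3] at hW
      have eu := euler c (p 0) (p 1) (p 2)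
      rw [hp] at eu
      simp only [gdot] at eu
      rw [show p 0 * qX c (p 0) (p 1) (p 2) - p 1 * -qY c (p 0) (p 1) (p 2) = - (p 2 * qZ c (p 0) (p 1) (p 2)) by
        linear_combination eu] at hW
      simp only [Gf] at hW ⊢
      linear_combination hW) p hp
  rw [eval_Gf, eval_qX, eval_qY, eval_qZ] at this
  simpa using this

lemma no_lin (h3 : (3 : k) = 0) {c : Fin 15 → k} (hc : Good c) (l : Fin 3 → k) (hl : l ≠ 0)
    (h : ∀ p : Fin 3 → k, qf c (p 0) (p 1) (p 2) = 0 → l 0 * qX c (p 0) (p 1) (p 2) + l 1 * qY c (p 0) (p 1) (p 2)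
      + l 2 * qZ c (p 0) (p 1) (p 2) = 0) : False := by
  have hz := van_low_hom hc (C (l 0) * qX (cC c) (X 0) (X 1) (X 2) + C (l 1) * qY (cC c) (X 0) (X 1) (X 2)
    + C (l 2) * qZ (cC c) (X 0) (X 1) (X 2)) (n := 3) (by norm_num) (by
      rw [← pd_qf0, ← pd_qf1, ← pd_qf2]
      have : ∀ i j, (C (l i) * pderiv j (Qp c)).IsHomogeneous 3 := by
        intro i j
        have := (isHomogeneous_C (Fin 3) (l i)).mul (hc.hom.pderiv (i := j))
        simpa using this
      exact ((this _ _).add (this _ _)).add (this _ _)) (fun p hp => by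
        have := h p hp
        simpa [eval_qX, eval_qY, eval_qZ] using this)
  have hz' : ∀ p : Fin 3 → k, l 0 * qX c (p 0) (p 1) (p 2) + l 1 * qY c (p 0) (p 1) (p 2)
      + l 2 * qZ c (p 0) (p 1) (p 2) = 0 := by
    intro p
    have := congrArg (eval p) hz
    simpa [eval_qX, eval_qY, eval_qZ] using this
  have fin : ∀ p : Fin 3 → k, p ≠ 0 → qX c (p 0) (p 1) (p 2) = 0 → qY c (p 0) (p 1) (p 2) = 0 →
      qZ c (p 0) (p 1) (p 2) = 0 → False := by
    intro p hp0 hX hY hZ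
    have eu := euler c (p 0) (p 1) (p 2)
    simp only [gdot, hX, hY, hZ] at eu
    obtain ⟨a, b, d⟩ := hc.sm _ _ _ (show qf c (p 0) (p 1) (p 2) = 0 by
      linear_combination (-1 : k) * eu - qf c (p 0) (p 1) (p 2) * h3) hX hY hZ
    exact hp0 (by ext i; fin_cases i <;> assumption)
  by_cases hl0 : l 0 = 0
  · by_cases hl1 : l 1 = 0
    · have hl2 : l 2 ≠ 0 := fun hl2 => hl (by ext i; fin_cases i <;> assumption)
      obtain ⟨p, hp0, ha, hb⟩ := bezout_aux (qX (cC c) (X 0) (X 1) (X 2)) (qY (cC c) (X 0) (X 1) (X 2))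
        (by rw [eval_qX]; simp [qX]) (by rw [eval_qY]; simp [qY])
      rw [eval_qX] at ha
      rw [eval_qY] at hb
      simp only [eval_X] at ha hb
      have := hz' p
      rw [ha, hb] at this
      exact fin p hp0 ha hb (by simpa [hl2] using this)
    · obtain ⟨p, hp0, ha, hb⟩ := bezout_aux (qX (cC c) (X 0) (X 1) (X 2)) (qZ (cC c) (X 0) (X 1) (X 2))
        (by rw [eval_qX]; simp [qX]) (by rw [eval_qZ]; simp [qZ])
      rw [eval_qX] at ha
      rw [eval_qZ] at hb
      simp only [eval_X] at ha hb
      have := hz' p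
      rw [ha, hb] at this
      exact fin p hp0 ha (by simpa [hl1] using this) hb
  · obtain ⟨p, hp0, ha, hb⟩ := bezout_aux (qY (cC c) (X 0) (X 1) (X 2)) (qZ (cC c) (X 0) (X 1) (X 2))
      (by rw [eval_qY]; simp [qY]) (by rw [eval_qZ]; simp [qZ])
    rw [eval_qY] at ha
    rw [eval_qZ] at hb
    simp only [eval_X] at ha hb
    have := hz' p
    rw [ha, hb] at this
    exact fin p hp0 (by simpa [hl0] using this) ha hb

/-- degenerate case -/
lemma degen_case (h3 : (3 : k) = 0) {c : Fin 15 → k} (hc : Good c) (hF : Flex c) (n : Fin 3 → k) (hn : n ≠ 0)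
    (h0 : c 12 * n 0 + c 8 * n 1 + c 7 * n 2 = 0)
    (h1 : c 8 * n 0 + c 5 * n 1 + c 4 * n 2 = 0)
    (h2 : c 7 * n 0 + c 4 * n 1 + c 3 * n 2 = 0) :
    c 3 = 0 ∧ c 4 = 0 ∧ c 5 = 0 ∧ c 7 = 0 ∧ c 8 = 0 ∧ c 12 = 0 := by
  obtain ⟨l, m, hlm⟩ := Gf_factor h3 c n hn h0 h1 h2
  by_cases hl : l = 0
  · exact Gf_zero h3 c (fun u v w => by rw [hlm, hl]; simp)
  by_cases hm : m = 0
  · exact Gf_zero h3 c (fun u v w => by rw [hlm, hm]; simp)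
  exfalso
  rcases van_mul hc (C (l 0) * qX (cC c) (X 0) (X 1) (X 2) + C (l 1) * qY (cC c) (X 0) (X 1) (X 2)
    + C (l 2) * qZ (cC c) (X 0) (X 1) (X 2)) (C (m 0) * qX (cC c) (X 0) (X 1) (X 2) + C (m 1) * qY (cC c) (X 0) (X 1) (X 2)
    + C (m 2) * qZ (cC c) (X 0) (X 1) (X 2)) (fun p hp => by
      have := Gg_van h3 hc hF p hp
      rw [hlm] at this
      simp only [map_add, map_mul, eval_C, eval_qX, eval_qY, eval_qZ, eval_X]
      exact this) with h | h
  · exact no_lin h3 hc l hl (fun p hp => by simpa [eval_qX, eval_qY, eval_qZ] using h p hp)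
  · exact no_lin h3 hc m hm (fun p hp => by simpa [eval_qX, eval_qY, eval_qZ] using h p hp)

end

section
variable {k : Type*} [Field k]

lemma cube_add (h3 : (3 : k) = 0) (a b : k) : (a + b) ^ 3 = a ^ 3 + b ^ 3 := by
  linear_combination (a ^ 2 * b + a * b ^ 2) * h3

/-- cubing as a ring homomorphism in characteristic 3 -/
def cubeHom (h3 : (3 : k) = 0) : k →+* k where
  toFun x := x ^ 3
  map_one' := by ring
  map_mul' x y := by ring
  map_zero' := by ring
  map_add' x y := cube_add h3 x y

lemma cubeHom_apply (h3 : (3 : k) = 0) (x : k) : cubeHom h3 x = x ^ 3 := rfl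

lemma fix_cube (h3 : (3 : k) = 0) (d : k) (h : d ^ 3 = d) : d = 0 ∨ d = 1 ∨ d = -1 := by
  have : d * ((d - 1) * (d + 1)) = 0 := by linear_combination h
  rcases mul_eq_zero.mp this with h | h
  · exact Or.inl h
  rcases mul_eq_zero.mp h with h | h
  · exact Or.inr (Or.inl (by linear_combination h))
  · exact Or.inr (Or.inr (by linear_combination h))

variable [IsAlgClosed k]

lemma cube_quad (h3 : (3 : k) = 0) {c : Fin 15 → k} (hc : Good c) (m1 m2 m3 m4 m5 m6 : k)
    (h : ∀ p : Fin 3 → k, qf c (p 0) (p 1) (p 2) = 0 → m1 * (p 0 ^ 3) ^ 2 + m2 * (p 1 ^ 3) ^ 2 + m3 * (p 2 ^ 3) ^ 2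
      + m4 * (p 0 ^ 3 * p 1 ^ 3) + m5 * (p 0 ^ 3 * p 2 ^ 3) + m6 * (p 1 ^ 3 * p 2 ^ 3) = 0) (p : Fin 3 → k) :
    m1 * (p 0 ^ 3) ^ 2 + m2 * (p 1 ^ 3) ^ 2 + m3 * (p 2 ^ 3) ^ 2
      + m4 * (p 0 ^ 3 * p 1 ^ 3) + m5 * (p 0 ^ 3 * p 2 ^ 3) + m6 * (p 1 ^ 3 * p 2 ^ 3) = 0 := by
  obtain ⟨n1, rfl⟩ := IsAlgClosed.exists_pow_nat_eq m1 (show 0 < 3 by norm_num)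
  obtain ⟨n2, rfl⟩ := IsAlgClosed.exists_pow_nat_eq m2 (show 0 < 3 by norm_num)
  obtain ⟨n3, rfl⟩ := IsAlgClosed.exists_pow_nat_eq m3 (show 0 < 3 by norm_num)
  obtain ⟨n4, rfl⟩ := IsAlgClosed.exists_pow_nat_eq m4 (show 0 < 3 by norm_num)
  obtain ⟨n5, rfl⟩ := IsAlgClosed.exists_pow_nat_eq m5 (show 0 < 3 by norm_num)
  obtain ⟨n6, rfl⟩ := IsAlgClosed.exists_pow_nat_eq m6 (show 0 < 3 by norm_num)
  set K : MvPolynomial (Fin 3) k := C n1 * X 0 ^ 2 + C n2 * X 1 ^ 2 + C n3 * X 2 ^ 2 + C n4 * (X 0 * X 1) + C n5 * (X 0 * X 2)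
    + C n6 * (X 1 * X 2) with hK
  have hKe : ∀ p : Fin 3 → k, eval p K ^ 3 = n1 ^ 3 * (p 0 ^ 3) ^ 2 + n2 ^ 3 * (p 1 ^ 3) ^ 2 + n3 ^ 3 * (p 2 ^ 3) ^ 2
      + n4 ^ 3 * (p 0 ^ 3 * p 1 ^ 3) + n5 ^ 3 * (p 0 ^ 3 * p 2 ^ 3) + n6 ^ 3 * (p 1 ^ 3 * p 2 ^ 3) := by
    intro p
    simp only [hK, map_add, map_mul, map_pow, eval_C, eval_X, cube_add h3]
    ring
  have hom : K.IsHomogeneous 2 := by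
    have a : ∀ (n : k) i, (C n * X i ^ 2 : MvPolynomial (Fin 3) k).IsHomogeneous 2 := fun n i => by
      simpa using (isHomogeneous_C (Fin 3) n).mul ((isHomogeneous_X k i).pow 2)
    have b : ∀ (n : k) i j, (C n * (X i * X j) : MvPolynomial (Fin 3) k).IsHomogeneous 2 := fun n i j => by
      simpa using (isHomogeneous_C (Fin 3) n).mul ((isHomogeneous_X k i).mul (isHomogeneous_X k j))
    exact (((((a _ _).add (a _ _)).add (a _ _)).add (b _ _ _)).add (b _ _ _)).add (b _ _ _)
  have := van_low_hom hc K (by norm_num) hom (fun p hp => by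
    have := h p hp
    rw [← hKe] at this
    exact pow_eq_zero_iff (by norm_num) |>.mp this)
  rw [← hKe, this]; simp

/-- no spanning set of fixed vectors of a nondegenerate form avoids the value one -/
lemma fixed_one (h3 : (3 : k) = 0) (e11 e22 e33 e12 e13 e23 : k)
    (D : (Fin 3 → k) → k)
    (hD : ∀ v, D v = e11 * v 0 ^ 2 + e22 * v 1 ^ 2 + e33 * v 2 ^ 2 + 2 * e12 * v 0 * v 1 + 2 * e13 * v 0 * v 2
      + 2 * e23 * v 1 * v 2)
    (hnd : ∀ v : Fin 3 → k, e11 * v 0 + e12 * v 1 + e13 * v 2 = 0 → e12 * v 0 + e22 * v 1 + e23 * v 2 = 0 →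
      e13 * v 0 + e23 * v 1 + e33 * v 2 = 0 → v = 0)
    (F : (Fin 3 → k) →ₛₗ[cubeHom h3] (Fin 3 → k)) (hF : Function.Injective F)
    (hDF : ∀ v, D (F v) = D v ^ 3) : ∃ v, F v = v ∧ D v = 1 := by
  by_contra! hcon
  have one_ne : (1 : k) ≠ -1 := fun h => by
    have : (1 : k) = 0 := by linear_combination h3 - h
    exact one_ne_zero this
  have val : ∀ v, F v = v → D v = 0 ∨ D v = -1 := by
    intro v hv
    have := hDF v
    rw [hv] at this
    rcases fix_cube h3 _ this.symm with h | h | h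
    · exact Or.inl h
    · exact absurd h (hcon v hv)
    · exact Or.inr h
  have fadd : ∀ v w, F v = v → F w = w → F (v + w) = v + w := fun v w hv hw => by rw [map_add, hv, hw]
  have fsub : ∀ v w, F v = v → F w = w → F (v - w) = v - w := fun v w hv hw => by rw [map_sub, hv, hw]
  have par : ∀ v w, D (v + w) + D (v - w) = 2 * D v + 2 * D w := by
    intro v w; simp only [hD, Pi.add_apply, Pi.sub_apply]; ring
  have span := lang_span (cubeHom h3) 3 (by norm_num) (fun x => rfl) F hF
  have n1 : ¬ ((1 : k) = 0 ∨ (1 : k) = -1) := by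
    rintro (h | h)
    · exact one_ne_zero h
    · exact one_ne h
  have iso : ∀ v, F v = v → D v = 0 → v = 0 := by
    intro v hv h0
    have pol : ∀ w, F w = w → (e11 * v 0 + e12 * v 1 + e13 * v 2) * w 0 + (e12 * v 0 + e22 * v 1 + e23 * v 2) * w 1
        + (e13 * v 0 + e23 * v 1 + e33 * v 2) * w 2 = 0 := by
      intro w hw
      have e : D (v + w) - D v - D w = 2 * ((e11 * v 0 + e12 * v 1 + e13 * v 2) * w 0 + (e12 * v 0 + e22 * v 1 + e23 * v 2) * w 1
        + (e13 * v 0 + e23 * v 1 + e33 * v 2) * w 2) := by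
        simp only [hD, Pi.add_apply]; ring
      have pr := par v w
      have va := val _ (fadd v w hv hw)
      have vs := val _ (fsub v w hv hw)
      have vw := val _ hw
      generalize (e11 * v 0 + e12 * v 1 + e13 * v 2) * w 0 + (e12 * v 0 + e22 * v 1 + e23 * v 2) * w 1
        + (e13 * v 0 + e23 * v 1 + e33 * v 2) * w 2 = β at *
      rw [h0] at e pr
      have eβ : β = D w - D (v + w) := by linear_combination β * h3 + e
      rcases vw with vw | vw <;> rcases va with va | va <;> rw [va, vw] at eβ pr <;> simp only [eβ]
      · ring
      · exfalso
        apply n1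
        rwa [show D (v - w) = 1 by linear_combination pr] at vs
      · exfalso
        apply n1
        rwa [show D (v - w) = 1 by linear_combination pr - h3] at vs
      · ring
    have pol' : ∀ w : Fin 3 → k, (e11 * v 0 + e12 * v 1 + e13 * v 2) * w 0 + (e12 * v 0 + e22 * v 1 + e23 * v 2) * w 1
        + (e13 * v 0 + e23 * v 1 + e33 * v 2) * w 2 = 0 := by
      intro w
      have hw : w ∈ Submodule.span k {v | F v = v} := by rw [span]; trivial
      induction hw using Submodule.span_induction with
      | mem x h => exact pol x h
      | zero => simp
      | add x y hx hy ihx ihy => simp only [Pi.add_apply]; linear_combination ihx + ihy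
      | smul d x hx ihx => simp only [Pi.smul_apply, smul_eq_mul]; linear_combination d * ihx
    apply hnd
    · simpa using pol' ![1, 0, 0]
    · simpa using pol' ![0, 1, 0]
    · simpa using pol' ![0, 0, 1]
  obtain ⟨x, hx0, hx⟩ := lang_one (cubeHom h3) 3 (by norm_num) (fun x => rfl) F hF
  obtain ⟨y, hy, hy0, hyx, hyx'⟩ : ∃ y, F y = y ∧ y ≠ 0 ∧ x + y ≠ 0 ∧ x - y ≠ 0 := by
    by_contra! hcon
    have hle : Submodule.span k {v | F v = v} ≤ Submodule.span k {x} := by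
      rw [Submodule.span_le]
      intro y hy
      show y ∈ Submodule.span k {x}
      by_cases h0 : y = 0
      · rw [h0]; exact Submodule.zero_mem _
      by_cases h1 : x + y = 0
      · rw [show y = - x by rw [← sub_eq_zero, sub_neg_eq_add, add_comm]; exact h1]
        exact Submodule.neg_mem _ (Submodule.mem_span_singleton_self x)
      · have := hcon y hy h0 h1
        rw [← sub_eq_zero.mp this]
        exact Submodule.mem_span_singleton_self x
    rw [span] at hle
    have h1 := finrank_span_singleton (K := k) hx0
    rw [top_le_iff.mp hle, finrank_top] at h1
    simp at h1
  have val' : ∀ v, F v = v → v ≠ 0 → D v = -1 := fun v hv h0 => by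
    rcases val v hv with h | h
    · exact absurd (iso v hv h) h0
    · exact h
  have := par x y
  rw [val' x hx hx0, val' y hy hy0, val' _ (fadd x y hx hy) hyx, val' _ (fsub x y hx hy) hyx'] at this
  exact one_ne (by linear_combination this)

end

section
variable {k : Type*} [Field k] [IsAlgClosed k]

lemma nondeg_core (h3 : (3 : k) = 0) {c : Fin 15 → k} (hc : Good c) (hF : Flex c)
    (e11 e22 e33 e12 e13 e23 δ : k) (hδ : δ ≠ 0)
    (s11 : e11 * c 12 + e12 * c 8 + e13 * c 7 = -δ) (s12 : e11 * c 8 + e12 * c 5 + e13 * c 4 = 0)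
    (s13 : e11 * c 7 + e12 * c 4 + e13 * c 3 = 0)
    (s21 : e12 * c 12 + e22 * c 8 + e23 * c 7 = 0) (s22 : e12 * c 8 + e22 * c 5 + e23 * c 4 = -δ)
    (s23 : e12 * c 7 + e22 * c 4 + e23 * c 3 = 0)
    (s31 : e13 * c 12 + e23 * c 8 + e33 * c 7 = 0) (s32 : e13 * c 8 + e23 * c 5 + e33 * c 4 = 0)
    (s33 : e13 * c 7 + e23 * c 4 + e33 * c 3 = -δ)
    (c3 : c 3 = 2 * e11 * e22 + 4 * e12 ^ 2) (c5 : c 5 = 2 * e11 * e33 + 4 * e13 ^ 2)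
    (c12 : c 12 = 2 * e22 * e33 + 4 * e23 ^ 2) (c4 : c 4 = 4 * e11 * e23 + 8 * e12 * e13)
    (c7 : c 7 = 4 * e22 * e13 + 8 * e12 * e23) (c8 : c 8 = 4 * e33 * e12 + 8 * e13 * e23) : False := by
  obtain ⟨a11, c0⟩ : ∃ a, c 0 = e11 ^ 2 + a := ⟨c 0 - e11 ^ 2, by ring⟩
  obtain ⟨a21, c1⟩ : ∃ a, c 1 = 4 * e11 * e12 + a := ⟨c 1 - 4 * e11 * e12, by ring⟩
  obtain ⟨a31, c2⟩ : ∃ a, c 2 = 4 * e11 * e13 + a := ⟨c 2 - 4 * e11 * e13, by ring⟩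
  obtain ⟨a12, c6⟩ : ∃ a, c 6 = 4 * e22 * e12 + a := ⟨c 6 - 4 * e22 * e12, by ring⟩
  obtain ⟨a22, c10⟩ : ∃ a, c 10 = e22 ^ 2 + a := ⟨c 10 - e22 ^ 2, by ring⟩
  obtain ⟨a32, c11⟩ : ∃ a, c 11 = 4 * e22 * e23 + a := ⟨c 11 - 4 * e22 * e23, by ring⟩
  obtain ⟨a13, c9⟩ : ∃ a, c 9 = 4 * e33 * e13 + a := ⟨c 9 - 4 * e33 * e13, by ring⟩
  obtain ⟨a23, c13⟩ : ∃ a, c 13 = 4 * e33 * e23 + a := ⟨c 13 - 4 * e33 * e23, by ring⟩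
  obtain ⟨a33, c14⟩ : ∃ a, c 14 = e33 ^ 2 + a := ⟨c 14 - e33 ^ 2, by ring⟩
  obtain ⟨D, hD⟩ : ∃ D : (Fin 3 → k) → k, ∀ v, D v = e11 * v 0 ^ 2 + e22 * v 1 ^ 2 + e33 * v 2 ^ 2 + 2 * e12 * v 0 * v 1
      + 2 * e13 * v 0 * v 2 + 2 * e23 * v 1 * v 2 := ⟨_, fun v => rfl⟩
  obtain ⟨H1, hH1⟩ : ∃ H : (Fin 3 → k) → k, ∀ v, H v = a11 * v 0 ^ 3 + a12 * v 1 ^ 3 + a13 * v 2 ^ 3 := ⟨_, fun v => rfl⟩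
  obtain ⟨H2, hH2⟩ : ∃ H : (Fin 3 → k) → k, ∀ v, H v = a21 * v 0 ^ 3 + a22 * v 1 ^ 3 + a23 * v 2 ^ 3 := ⟨_, fun v => rfl⟩
  obtain ⟨H3, hH3⟩ : ∃ H : (Fin 3 → k) → k, ∀ v, H v = a31 * v 0 ^ 3 + a32 * v 1 ^ 3 + a33 * v 2 ^ 3 := ⟨_, fun v => rfl⟩
  have hq : ∀ v, qf c (v 0) (v 1) (v 2) = D v ^ 2 + H1 v * v 0 + H2 v * v 1 + H3 v * v 2 := by
    intro v
    simp only [qf, hD, hH1, hH2, hH3, c0, c1, c2, c3, c4, c5, c6, c7, c8, c9, c10, c11, c12, c13, c14]; ring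
  have hX : ∀ v, qX c (v 0) (v 1) (v 2) = 4 * D v * (e11 * v 0 + e12 * v 1 + e13 * v 2) + H1 v := by
    intro v
    simp only [qX, hD, hH1, hH2, hH3, c0, c1, c2, c3, c4, c5, c6, c7, c8, c9, c10, c11, c12, c13, c14]
    linear_combination (v 0 ^ 2 * (a11 * v 0 + a21 * v 1 + a31 * v 2)) * h3
  have hY : ∀ v, qY c (v 0) (v 1) (v 2) = 4 * D v * (e12 * v 0 + e22 * v 1 + e23 * v 2) + H2 v := by
    intro v
    simp only [qY, hD, hH1, hH2, hH3, c0, c1, c2, c3, c4, c5, c6, c7, c8, c9, c10, c11, c12, c13, c14]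
    linear_combination (v 1 ^ 2 * (a12 * v 0 + a22 * v 1 + a32 * v 2)) * h3
  have hZ : ∀ v, qZ c (v 0) (v 1) (v 2) = 4 * D v * (e13 * v 0 + e23 * v 1 + e33 * v 2) + H3 v := by
    intro v
    simp only [qZ, hD, hH1, hH2, hH3, c0, c1, c2, c3, c4, c5, c6, c7, c8, c9, c10, c11, c12, c13, c14]
    linear_combination (v 2 ^ 2 * (a13 * v 0 + a23 * v 1 + a33 * v 2)) * h3
  clear c0 c1 c2 c3 c4 c5 c6 c7 c8 c9 c10 c11 c12 c13 c14
  -- on the curve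
  have onC : ∀ v : Fin 3 → k, qf c (v 0) (v 1) (v 2) = 0 → Gf c (H1 v) (H2 v) (H3 v) + δ * D v ^ 3 = 0 := by
    intro v hv
    have g := Gg_van h3 hc hF v hv
    rw [hq] at hv
    rw [hX, hY, hZ] at g
    have L1 : c 12 * (e11 * v 0 + e12 * v 1 + e13 * v 2) + c 8 * (e12 * v 0 + e22 * v 1 + e23 * v 2)
      + c 7 * (e13 * v 0 + e23 * v 1 + e33 * v 2) = -δ * v 0 := by
      linear_combination v 0 * s11 + v 1 * s21 + v 2 * s31
    have L2 : c 8 * (e11 * v 0 + e12 * v 1 + e13 * v 2) + c 5 * (e12 * v 0 + e22 * v 1 + e23 * v 2)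
      + c 4 * (e13 * v 0 + e23 * v 1 + e33 * v 2) = -δ * v 1 := by
      linear_combination v 0 * s12 + v 1 * s22 + v 2 * s32
    have L3 : c 7 * (e11 * v 0 + e12 * v 1 + e13 * v 2) + c 4 * (e12 * v 0 + e22 * v 1 + e23 * v 2)
      + c 3 * (e13 * v 0 + e23 * v 1 + e33 * v 2) = -δ * v 2 := by
      linear_combination v 0 * s13 + v 1 * s23 + v 2 * s33
    have LD : (e11 * v 0 + e12 * v 1 + e13 * v 2) * v 0 + (e12 * v 0 + e22 * v 1 + e23 * v 2) * v 1
      + (e13 * v 0 + e23 * v 1 + e33 * v 2) * v 2 = D v := by rw [hD]; ring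
    generalize e11 * v 0 + e12 * v 1 + e13 * v 2 = l1 at *
    generalize e12 * v 0 + e22 * v 1 + e23 * v 2 = l2 at *
    generalize e13 * v 0 + e23 * v 1 + e33 * v 2 = l3 at *
    simp only [Gf] at g ⊢
    linear_combination g - (16 * D v ^ 2 * l1 + 8 * D v * H1 v) * L1 - (16 * D v ^ 2 * l2 + 8 * D v * H2 v) * L2
      - (16 * D v ^ 2 * l3 + 8 * D v * H3 v) * L3 + 16 * δ * D v ^ 2 * LD + 8 * D v * δ * hv + 3 * δ * D v ^ 3 * h3
  -- everywhere
  have D3 : ∀ v, D v ^ 3 = e11 ^ 3 * (v 0 ^ 3) ^ 2 + e22 ^ 3 * (v 1 ^ 3) ^ 2 + e33 ^ 3 * (v 2 ^ 3) ^ 2 + 8 * e12 ^ 3 * v 0 ^ 3 * v 1 ^ 3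
      + 8 * e13 ^ 3 * v 0 ^ 3 * v 2 ^ 3 + 8 * e23 ^ 3 * v 1 ^ 3 * v 2 ^ 3 := by
    intro v
    simp only [hD, cube_add h3]; ring
  have all : ∀ v : Fin 3 → k, Gf c (H1 v) (H2 v) (H3 v) + δ * D v ^ 3 = 0 := by
    have ex : ∀ v : Fin 3 → k, Gf c (H1 v) (H2 v) (H3 v) + δ * D v ^ 3 =
      (Gf c a11 a21 a31 + δ * e11 ^ 3) * (v 0 ^ 3) ^ 2 + (Gf c a12 a22 a32 + δ * e22 ^ 3) * (v 1 ^ 3) ^ 2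
      + (Gf c a13 a23 a33 + δ * e33 ^ 3) * (v 2 ^ 3) ^ 2
      + (Gf c (a11 + a12) (a21 + a22) (a31 + a32) - Gf c a11 a21 a31 - Gf c a12 a22 a32 + δ * (8 * e12 ^ 3)) * (v 0 ^ 3 * v 1 ^ 3)
      + (Gf c (a11 + a13) (a21 + a23) (a31 + a33) - Gf c a11 a21 a31 - Gf c a13 a23 a33 + δ * (8 * e13 ^ 3)) * (v 0 ^ 3 * v 2 ^ 3)
      + (Gf c (a12 + a13) (a22 + a23) (a32 + a33) - Gf c a12 a22 a32 - Gf c a13 a23 a33 + δ * (8 * e23 ^ 3)) * (v 1 ^ 3 * v 2 ^ 3) := by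
      intro v
      rw [D3]
      simp only [Gf, hH1, hH2, hH3]; ring
    intro v
    rw [ex]
    apply cube_quad h3 hc
    intro p hp
    rw [← ex]
    exact onC p hp
  let F : (Fin 3 → k) →ₛₗ[cubeHom h3] (Fin 3 → k) :=
    { toFun := fun v => ![δ⁻¹ * (c 12 * H1 v + c 8 * H2 v + c 7 * H3 v), δ⁻¹ * (c 8 * H1 v + c 5 * H2 v + c 4 * H3 v),
        δ⁻¹ * (c 7 * H1 v + c 4 * H2 v + c 3 * H3 v)]
      map_add' := fun v w => by
        ext i; fin_cases i <;> simp [hH1, hH2, hH3, cube_add h3] <;> ring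
      map_smul' := fun r w => by
        ext i; fin_cases i <;> simp [hH1, hH2, hH3, cubeHom_apply] <;> ring }
  have F0 : ∀ v, F v 0 = δ⁻¹ * (c 12 * H1 v + c 8 * H2 v + c 7 * H3 v) := fun v => rfl
  have F1 : ∀ v, F v 1 = δ⁻¹ * (c 8 * H1 v + c 5 * H2 v + c 4 * H3 v) := fun v => rfl
  have F2 : ∀ v, F v 2 = δ⁻¹ * (c 7 * H1 v + c 4 * H2 v + c 3 * H3 v) := fun v => rfl
  clear_value F
  have hδi : δ⁻¹ * δ = 1 := inv_mul_cancel₀ hδ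
  have E1 : ∀ v, e11 * F v 0 + e12 * F v 1 + e13 * F v 2 = - H1 v := fun v => by
    rw [F0, F1, F2]
    linear_combination δ⁻¹ * H1 v * s11 + δ⁻¹ * H2 v * s12 + δ⁻¹ * H3 v * s13 - H1 v * hδi
  have E2 : ∀ v, e12 * F v 0 + e22 * F v 1 + e23 * F v 2 = - H2 v := fun v => by
    rw [F0, F1, F2]
    linear_combination δ⁻¹ * H1 v * s21 + δ⁻¹ * H2 v * s22 + δ⁻¹ * H3 v * s23 - H2 v * hδi
  have E3 : ∀ v, e13 * F v 0 + e23 * F v 1 + e33 * F v 2 = - H3 v := fun v => by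
    rw [F0, F1, F2]
    linear_combination δ⁻¹ * H1 v * s31 + δ⁻¹ * H2 v * s32 + δ⁻¹ * H3 v * s33 - H3 v * hδi
  have sing : ∀ v : Fin 3 → k, qf c (v 0) (v 1) (v 2) = 0 → qX c (v 0) (v 1) (v 2) = 0 → qY c (v 0) (v 1) (v 2) = 0 →
      qZ c (v 0) (v 1) (v 2) = 0 → v = 0 := by
    intro v a b d e
    obtain ⟨x, y, z⟩ := hc.sm _ _ _ a b d e
    ext i; fin_cases i <;> assumption
  obtain ⟨v, hv, hv1⟩ := fixed_one h3 e11 e22 e33 e12 e13 e23 D hD (by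
      intro v h1 h2 h3
      have x0 : δ * v 0 = 0 := by
        linear_combination v 0 * s11 + v 1 * s21 + v 2 * s31 - c 12 * h1 - c 8 * h2 - c 7 * h3
      have x1 : δ * v 1 = 0 := by
        linear_combination v 0 * s12 + v 1 * s22 + v 2 * s32 - c 8 * h1 - c 5 * h2 - c 4 * h3
      have x2 : δ * v 2 = 0 := by
        linear_combination v 0 * s13 + v 1 * s23 + v 2 * s33 - c 7 * h1 - c 4 * h2 - c 3 * h3
      ext i; fin_cases i
      · simpa [hδ] using x0
      · simpa [hδ] using x1
      · simpa [hδ] using x2) F (by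
      rw [injective_iff_map_eq_zero]
      intro v hv
      have a1 := E1 v
      have a2 := E2 v
      have a3 := E3 v
      simp only [hv, Pi.zero_apply, mul_zero, add_zero] at a1 a2 a3
      have b1 : H1 v = 0 := by linear_combination a1
      have b2 : H2 v = 0 := by linear_combination a2
      have b3 : H3 v = 0 := by linear_combination a3
      have hd := all v
      rw [b1, b2, b3] at hd
      have hd' : D v = 0 := by
        simpa [Gf, hδ] using hd
      apply sing
      · rw [hq, b1, b2, b3, hd']; ring
      · rw [hX, b1, hd']; ring
      · rw [hY, b2, hd']; ring
      · rw [hZ, b3, hd']; ring) (by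
      intro v
      have e : D (F v) = (e11 * F v 0 + e12 * F v 1 + e13 * F v 2) * F v 0 + (e12 * F v 0 + e22 * F v 1 + e23 * F v 2) * F v 1
        + (e13 * F v 0 + e23 * F v 1 + e33 * F v 2) * F v 2 := by rw [hD]; ring
      rw [e, E1, E2, E3, F0, F1, F2]
      have := all v
      simp only [Gf] at this
      linear_combination -δ⁻¹ * this + D v ^ 3 * hδi)
  have a1 := E1 v
  have a2 := E2 v
  have a3 := E3 v
  rw [hv] at a1 a2 a3
  have e : D v = (e11 * v 0 + e12 * v 1 + e13 * v 2) * v 0 + (e12 * v 0 + e22 * v 1 + e23 * v 2) * v 1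
        + (e13 * v 0 + e23 * v 1 + e33 * v 2) * v 2 := by rw [hD]; ring
  rw [a1, a2, a3] at e
  have : v = 0 := by
    apply sing
    · rw [hq]; linear_combination e + (D v) * hv1
    · rw [hX, hv1, a1]; linear_combination -H1 v * h3
    · rw [hY, hv1, a2]; linear_combination -H2 v * h3
    · rw [hZ, hv1, a3]; linear_combination -H3 v * h3
  rw [hD, this] at hv1
  simp at hv1

lemma six_zero (h3 : (3 : k) = 0) {c : Fin 15 → k} (hc : Good c) (hF : Flex c) :
    c 3 = 0 ∧ c 4 = 0 ∧ c 5 = 0 ∧ c 7 = 0 ∧ c 8 = 0 ∧ c 12 = 0 := by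
  set S : Matrix (Fin 3) (Fin 3) k := !![c 12, c 8, c 7; c 8, c 5, c 4; c 7, c 4, c 3] with hS
  by_cases hdet : S.det = 0
  · obtain ⟨n, hn, h⟩ := Matrix.exists_mulVec_eq_zero_iff.mpr hdet
    have h0 := congrFun h 0
    have h1 := congrFun h 1
    have h2 := congrFun h 2
    simp [hS, Matrix.mulVec, dotProduct, Fin.sum_univ_three] at h0 h1 h2
    exact degen_case h3 hc hF n hn h0 h1 h2
  · exfalso
    obtain ⟨t, ht⟩ := IsAlgClosed.exists_pow_nat_eq (-1 / S.det) (show 0 < 2 by norm_num)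
    have ht' : t ^ 2 * S.det = -1 := by rw [ht]; field_simp
    have ht0 : t ≠ 0 := by rintro rfl; simp at ht'
    have hδ : -(t * S.det) ≠ 0 := neg_ne_zero.mpr (mul_ne_zero ht0 hdet)
    have hd : S.det = c 12 * (c 5 * c 3 - c 4 ^ 2) - c 8 * (c 8 * c 3 - c 4 * c 7) + c 7 * (c 8 * c 4 - c 5 * c 7) := by
      rw [Matrix.det_fin_three]
      simp [hS]; ring
    rw [hd] at ht' hδ
    obtain ⟨e11, h11⟩ : ∃ e, e = t * (c 5 * c 3 - c 4 ^ 2) := ⟨_, rfl⟩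
    obtain ⟨e22, h22⟩ : ∃ e, e = t * (c 12 * c 3 - c 7 ^ 2) := ⟨_, rfl⟩
    obtain ⟨e33, h33⟩ : ∃ e, e = t * (c 12 * c 5 - c 8 ^ 2) := ⟨_, rfl⟩
    obtain ⟨e12, h12⟩ : ∃ e, e = t * (c 4 * c 7 - c 8 * c 3) := ⟨_, rfl⟩
    obtain ⟨e13, h13⟩ : ∃ e, e = t * (c 8 * c 4 - c 7 * c 5) := ⟨_, rfl⟩
    obtain ⟨e23, h23⟩ : ∃ e, e = t * (c 7 * c 8 - c 12 * c 4) := ⟨_, rfl⟩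
    refine nondeg_core h3 hc hF e11 e22 e33 e12 e13 e23 _ hδ ?_ ?_ ?_ ?_ ?_ ?_ ?_ ?_ ?_ ?_ ?_ ?_ ?_ ?_ ?_
    any_goals (rw [h11, h12, h13]; ring1)
    any_goals (rw [h12, h22, h23]; ring1)
    any_goals (rw [h13, h23, h33]; ring1)
    · have : e11 * e22 - e12 ^ 2 = -c 3 := by rw [h11, h12, h22]; linear_combination c 3 * ht'
      linear_combination this - (e11 * e22 + e12 ^ 2) * h3
    · have : e11 * e33 - e13 ^ 2 = -c 5 := by rw [h11, h13, h33]; linear_combination c 5 * ht'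
      linear_combination this - (e11 * e33 + e13 ^ 2) * h3
    · have : e22 * e33 - e23 ^ 2 = -c 12 := by rw [h22, h23, h33]; linear_combination c 12 * ht'
      linear_combination this - (e22 * e33 + e23 ^ 2) * h3
    · have : e12 * e13 - e11 * e23 = -c 4 := by rw [h11, h12, h13, h23]; linear_combination c 4 * ht'
      linear_combination this - (e11 * e23 + 3 * e12 * e13) * h3
    · have : e12 * e23 - e22 * e13 = -c 7 := by rw [h22, h12, h13, h23]; linear_combination c 7 * ht'
      linear_combination this - (e22 * e13 + 3 * e12 * e23) * h3
    · have : e13 * e23 - e33 * e12 = -c 8 := by rw [h33, h12, h13, h23]; linear_combination c 8 * ht'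
      linear_combination this - (e33 * e12 + 3 * e13 * e23) * h3

end

section
variable {k : Type*} [Field k] [IsAlgClosed k]

lemma herm_step (h3 : (3 : k) = 0)
    (B : (Fin 3 → k) →ₛₗ[cubeHom h3] (Fin 3 → k) →ₗ[k] k) (hnd : ∀ x, (∀ y, B x y = 0) → x = 0)
    (F : (Fin 3 → k) →ₛₗ[(cubeHom h3).comp (cubeHom h3)] (Fin 3 → k)) (hF : Function.Injective F)
    (hBF : ∀ v w, B w (F v) = B v w ^ 3)
    (r : ℕ) (hr : r < 3) (v : Fin r → (Fin 3 → k)) (hfix : ∀ i, F (v i) = v i)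
    (horth : ∀ i j, i ≠ j → B (v i) (v j) = 0) (hne : ∀ i, B (v i) (v i) ≠ 0) :
    ∃ u, F u = u ∧ (∀ i, B (v i) u = 0) ∧ B u u ≠ 0 := by
  by_contra! hcon
  have hσ : ∀ x : k, (cubeHom h3).comp (cubeHom h3) x = x ^ 9 := fun x => by
    simp only [RingHom.comp_apply, cubeHom_apply]; ring
  have span := lang_span _ 9 (by norm_num) hσ F hF
  have sym : ∀ x y, F x = x → B y x = B x y ^ 3 := fun x y hx => by
    rw [← hBF, hx]
  have nine : ∀ x y, F x = x → F y = y → B x y ^ 9 = B x y := fun x y hx hy => by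
    have : B x y = (B x y ^ 3) ^ 3 := by
      conv_lhs => rw [sym y x hy, sym x y hx]
    rw [show (9 : ℕ) = 3 * 3 by norm_num, pow_mul]; exact this.symm
  obtain ⟨ι, hι⟩ := IsAlgClosed.exists_pow_nat_eq (-1 : k) (show 0 < 2 by norm_num)
  have two_ne : (2 : k) ≠ 0 := fun h => one_ne_zero (by linear_combination h3 - h : (1 : k) = 0)
  have hι0 : ι ≠ 0 := by rintro rfl; simp at hι
  have pair : ∀ x y, F x = x → F y = y → (∀ i, B (v i) x = 0) → (∀ i, B (v i) y = 0) → B x y = 0 := by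
    intro x y hx hy ox oy
    have key : ∀ ζ : k, ζ ^ 9 = ζ → ζ * B x y + ζ ^ 3 * B x y ^ 3 = 0 := by
      intro ζ hζ
      have a := hcon (x + ζ • y) (by rw [map_add, map_smulₛₗ, hσ, hζ, hx, hy])
        (fun i => by rw [map_add, map_smul, ox, oy]; simp)
      have bx := hcon x hx ox
      have bY := hcon y hy oy
      simp only [map_add, LinearMap.add_apply, map_smulₛₗ, LinearMap.smul_apply, smul_eq_mul, cubeHom_apply, bx, bY,
        sym x y hx, RingHom.id_apply] at a
      linear_combination a
    have a := key 1 (by ring)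
    have b := key ι (by linear_combination (ι * (ι ^ 6 - ι ^ 4 + ι ^ 2 - 1)) * hι)
    have b' : ι * (B x y - B x y ^ 3) = 0 := by linear_combination b - ι * B x y ^ 3 * hι
    have b2 : B x y - B x y ^ 3 = 0 := by simpa [hι0] using b'
    have : 2 * B x y = 0 := by linear_combination a + b2
    simpa [two_ne] using this
  set π : (Fin 3 → k) → (Fin 3 → k) := fun w => w - ∑ i, (B (v i) w / B (v i) (v i)) • v i with hπ
  have πfix : ∀ w, F w = w → F (π w) = π w := by
    intro w hw
    simp only [hπ, map_sub, map_sum, map_smulₛₗ, hfix, hw, hσ, div_pow]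
    congr 1
    apply Finset.sum_congr rfl
    intro i _
    rw [nine _ _ (hfix i) hw, nine _ _ (hfix i) (hfix i)]
  have πorth : ∀ w j, B (v j) (π w) = 0 := by
    intro w j
    simp only [hπ, map_sub, map_sum, map_smul, smul_eq_mul]
    rw [Finset.sum_eq_single j]
    · rw [div_mul_cancel₀ _ (hne j), sub_self]
    · intro i _ hij
      rw [horth j i hij.symm, mul_zero]
    · simp
  have πorth' : ∀ w j, B (π w) (v j) = 0 := by
    intro w j
    rw [sym (v j) _ (hfix j), πorth]; ring
  have πz : ∀ w, F w = w → π w = 0 := by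
    intro w hw
    apply hnd
    intro y
    have hy : y ∈ Submodule.span k {v | F v = v} := by rw [span]; trivial
    induction hy using Submodule.span_induction with
    | mem y h =>
      have e : y = π y + ∑ i, (B (v i) y / B (v i) (v i)) • v i := by simp [hπ]
      have p := pair _ _ (πfix w hw) (πfix y h) (πorth w) (πorth y)
      rw [e, map_add, p, map_sum]
      simp [πorth']
    | zero => simp
    | add x y hx hy ihx ihy => rw [map_add, ihx, ihy, add_zero]
    | smul d x hx ihx => rw [map_smul, ihx, smul_zero]
  have hle : Submodule.span k {v | F v = v} ≤ Submodule.span k (Set.range v) := by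
    rw [Submodule.span_le]
    intro w hw
    have := πz w hw
    rw [sub_eq_zero] at this
    show w ∈ Submodule.span k (Set.range v)
    rw [this]
    apply Submodule.sum_mem
    intro i _
    exact Submodule.smul_mem _ _ (Submodule.subset_span ⟨i, rfl⟩)
  rw [span] at hle
  have h1 := finrank_range_le_card (R := k) v
  rw [Set.finrank, top_le_iff.mp hle, finrank_top] at h1
  simp at h1
  omega

lemma herm_basis (h3 : (3 : k) = 0)
    (B : (Fin 3 → k) →ₛₗ[cubeHom h3] (Fin 3 → k) →ₗ[k] k) (hnd : ∀ x, (∀ y, B x y = 0) → x = 0)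
    (F : (Fin 3 → k) →ₛₗ[(cubeHom h3).comp (cubeHom h3)] (Fin 3 → k)) (hF : Function.Injective F)
    (hBF : ∀ v w, B w (F v) = B v w ^ 3) :
    ∃ m : Fin 3 → (Fin 3 → k), ∀ i j, B (m i) (m j) = if i = j then 1 else 0 := by
  have ind : ∀ r, r ≤ 3 → ∃ v : Fin r → (Fin 3 → k), (∀ i, F (v i) = v i) ∧
      (∀ i j, i ≠ j → B (v i) (v j) = 0) ∧ (∀ i, B (v i) (v i) ≠ 0) := by
    intro r
    induction r with
    | zero => intro _; exact ⟨fun i => i.elim0, fun i => i.elim0, fun i => i.elim0, fun i => i.elim0⟩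
    | succ r ih =>
      intro hr
      obtain ⟨v, h1, h2, h4⟩ := ih (by omega)
      obtain ⟨u, hu, ho, hn⟩ := herm_step h3 B hnd F hF hBF r (by omega) v h1 h2 h4
      have ho' : ∀ i, B u (v i) = 0 := fun i => by
        have := hBF (v i) u
        rw [h1, ho] at this
        rw [this]; ring
      refine ⟨Fin.snoc v u, ?_, ?_, ?_⟩
      · intro i
        refine Fin.lastCases ?_ (fun i => ?_) i
        · simpa using hu
        · simpa using h1 i
      · intro i j
        refine Fin.lastCases ?_ (fun i => ?_) i <;> refine Fin.lastCases ?_ (fun j => ?_) j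
        · intro h; exact absurd rfl h
        · intro _; simpa using ho' j
        · intro _; simpa using ho i
        · intro h
          simpa using h2 i j (fun hij => h (by rw [hij]))
      · intro i
        refine Fin.lastCases ?_ (fun i => ?_) i
        · simpa using hn
        · simpa using h4 i
  obtain ⟨v, -, h2, h4⟩ := ind 3 le_rfl
  have : ∀ i, ∃ c : k, c ^ 4 * B (v i) (v i) = 1 := by
    intro i
    obtain ⟨c, hc⟩ := IsAlgClosed.exists_pow_nat_eq (B (v i) (v i))⁻¹ (show 0 < 4 by norm_num)
    exact ⟨c, by rw [hc, inv_mul_cancel₀ (h4 i)]⟩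
  choose c hc using this
  refine ⟨fun i => c i • v i, fun i j => ?_⟩
  simp only [map_smulₛₗ, LinearMap.smul_apply, smul_eq_mul, cubeHom_apply, RingHom.id_apply]
  split_ifs with h
  · subst h
    rw [← hc i]; ring
  · rw [h2 i j h]; ring

end

section
variable {k : Type*} [Field k]

/-- the sesquilinear form attached to a matrix -/
def sesq (h3 : (3 : k) = 0) (A : Matrix (Fin 3) (Fin 3) k) :
    (Fin 3 → k) →ₛₗ[cubeHom h3] (Fin 3 → k) →ₗ[k] k :=
  LinearMap.mk₂'ₛₗ (cubeHom h3) (RingHom.id k) (fun v w => ∑ i, v i ^ 3 * (A.mulVec w) i)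
    (by
      intro v v' w
      simp only [Pi.add_apply, cube_add h3, add_mul, Finset.sum_add_distrib])
    (by
      intro a v w
      simp only [Pi.smul_apply, smul_eq_mul, Finset.mul_sum, cubeHom_apply]
      exact Finset.sum_congr rfl fun i _ => by ring)
    (by
      intro v w w'
      simp only [Matrix.mulVec_add, Pi.add_apply, mul_add, Finset.sum_add_distrib])
    (by
      intro a v w
      simp only [Matrix.mulVec_smul, Pi.smul_apply, smul_eq_mul, Finset.mul_sum, RingHom.id_apply]
      exact Finset.sum_congr rfl fun i _ => by ring)

lemma sesq_apply (h3 : (3 : k) = 0) (A : Matrix (Fin 3) (Fin 3) k) (v w : Fin 3 → k) :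
    sesq h3 A v w = ∑ i, v i ^ 3 * (A.mulVec w) i := rfl

variable [IsAlgClosed k]

lemma sesq_basis (h3 : (3 : k) = 0) (A : Matrix (Fin 3) (Fin 3) k)
    (hnd : ∀ x, (∀ y, sesq h3 A x y = 0) → x = 0) :
    ∃ m : Fin 3 → (Fin 3 → k), ∀ i j, sesq h3 A (m i) (m j) = if i = j then 1 else 0 := by
  have hdet : A.det ≠ 0 := by
    intro h
    obtain ⟨u, hu, h0⟩ := Matrix.exists_vecMul_eq_zero_iff.mpr h
    choose r hr using fun i => IsAlgClosed.exists_pow_nat_eq (u i) (show 0 < 3 by norm_num)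
    apply hu
    have : r = 0 := by
      apply hnd
      intro y
      rw [sesq_apply]
      simp only [hr]
      change u ⬝ᵥ A.mulVec y = 0
      rw [Matrix.dotProduct_mulVec, h0, zero_dotProduct]
    funext i
    rw [← hr i, this]; simp
  let σ := (cubeHom h3).comp (cubeHom h3)
  have hσ : ∀ x, σ x = (x ^ 3) ^ 3 := fun x => rfl
  let F0 : (Fin 3 → k) →ₛₗ[σ] (Fin 3 → k) :=
    { toFun := fun v => A⁻¹.mulVec (fun j => ∑ i, A i j ^ 3 * (v i ^ 3) ^ 3)
      map_add' := by
        intro v w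
        rw [← Matrix.mulVec_add]
        congr 1
        funext j
        simp only [Pi.add_apply, cube_add h3, mul_add, Finset.sum_add_distrib]
      map_smul' := by
        intro a v
        rw [← Matrix.mulVec_smul]
        congr 1
        funext j
        simp only [Pi.smul_apply, smul_eq_mul, Finset.mul_sum, hσ]
        exact Finset.sum_congr rfl fun i _ => by ring }
  have hF0 : ∀ v, F0 v = A⁻¹.mulVec (fun j => ∑ i, A i j ^ 3 * (v i ^ 3) ^ 3) := fun v => rfl
  have hAF : ∀ v, A.mulVec (F0 v) = fun j => ∑ i, A i j ^ 3 * (v i ^ 3) ^ 3 := by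
    intro v
    rw [hF0, Matrix.mulVec_mulVec, Matrix.mul_nonsing_inv _ (isUnit_iff_ne_zero.mpr hdet), Matrix.one_mulVec]
  have hBF : ∀ v w, sesq h3 A w (F0 v) = sesq h3 A v w ^ 3 := by
    intro v w
    rw [sesq_apply, hAF, sesq_apply]
    simp only [Matrix.mulVec, dotProduct, Fin.sum_univ_three, cube_add h3, mul_pow]
    ring
  refine herm_basis h3 (sesq h3 A) hnd F0 ?_ hBF
  rw [injective_iff_map_eq_zero]
  intro v hv
  apply hnd
  intro w
  have := hBF v w
  rw [hv, map_zero] at this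
  exact pow_eq_zero_iff (by norm_num) |>.mp this.symm

lemma fermat_of_six (h3 : (3 : k) = 0) {c : Fin 15 → k} (hc : Good c)
    (h : c 3 = 0 ∧ c 4 = 0 ∧ c 5 = 0 ∧ c 7 = 0 ∧ c 8 = 0 ∧ c 12 = 0) :
    ∃ M : Matrix (Fin 3) (Fin 3) k, IsUnit M.det ∧
        substM M (Qp c) = X 0 ^ 4 + X 1 ^ 4 + X 2 ^ 4 := by
  obtain ⟨c3, c4, c5, c7, c8, c12⟩ := h
  set A : Matrix (Fin 3) (Fin 3) k := !![c 0, c 1, c 2; c 6, c 10, c 11; c 9, c 13, c 14] with hA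
  have hS : ∀ v w, sesq h3 A v w = v 0 ^ 3 * (c 0 * w 0 + c 1 * w 1 + c 2 * w 2)
      + v 1 ^ 3 * (c 6 * w 0 + c 10 * w 1 + c 11 * w 2) + v 2 ^ 3 * (c 9 * w 0 + c 13 * w 1 + c 14 * w 2) := by
    intro v w
    rw [sesq_apply]
    simp [hA, Matrix.mulVec, dotProduct, Fin.sum_univ_three]
  have hnd : ∀ x, (∀ y, sesq h3 A x y = 0) → x = 0 := by
    intro x hx
    have e0 := hx ![1, 0, 0]
    have e1 := hx ![0, 1, 0]
    have e2 := hx ![0, 0, 1]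
    have ex := hx x
    simp only [hS] at e0 e1 e2 ex
    simp at e0 e1 e2
    have := hc.sm (x 0) (x 1) (x 2) (by
        simp only [qf, c3, c4, c5, c7, c8, c12]; linear_combination ex) (by
        simp only [qX, c3, c4, c5, c7, c8, c12]
        linear_combination e0 + (c 0 * x 0 ^ 3 + c 1 * x 0 ^ 2 * x 1 + c 2 * x 0 ^ 2 * x 2) * h3) (by
        simp only [qY, c3, c4, c5, c7, c8, c12]
        linear_combination e1 + (c 6 * x 0 * x 1 ^ 2 + c 10 * x 1 ^ 3 + c 11 * x 1 ^ 2 * x 2) * h3) (by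
        simp only [qZ, c3, c4, c5, c7, c8, c12]
        linear_combination e2 + (c 9 * x 0 * x 2 ^ 2 + c 13 * x 1 * x 2 ^ 2 + c 14 * x 2 ^ 3) * h3)
    funext i
    fin_cases i
    · exact this.1
    · exact this.2.1
    · exact this.2.2
  obtain ⟨m, hm⟩ := sesq_basis h3 A hnd
  refine ⟨Matrix.of fun i j => m j i, ?_, ?_⟩
  · rw [isUnit_iff_ne_zero]
    intro h
    obtain ⟨n, hn, h0⟩ := Matrix.exists_mulVec_eq_zero_iff.mpr h
    apply hn
    have hs : ∑ j, n j • m j = 0 := by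
      funext i
      have := congrFun h0 i
      simp only [Matrix.mulVec, dotProduct, Matrix.of_apply] at this
      simp only [Finset.sum_apply, Pi.smul_apply, smul_eq_mul]
      rw [← this]
      exact Finset.sum_congr rfl fun j _ => mul_comm _ _
    funext i
    have := congrArg (sesq h3 A (m i)) hs
    simpa [map_sum, map_smul, hm] using this
  · have h3' : (3 : MvPolynomial (Fin 3) k) = 0 := by
      rw [show (3 : MvPolynomial (Fin 3) k) = C 3 from (map_ofNat C 3).symm, h3, C_0]
    have ca : ∀ a b : MvPolynomial (Fin 3) k, (a + b) ^ 3 = a ^ 3 + b ^ 3 := fun a b => by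
      linear_combination (a ^ 2 * b + a * b ^ 2) * h3'
    have e : ∀ i j, (C (m i 0) ^ 3 * (C (c 0) * C (m j 0) + C (c 1) * C (m j 1) + C (c 2) * C (m j 2))
      + C (m i 1) ^ 3 * (C (c 6) * C (m j 0) + C (c 10) * C (m j 1) + C (c 11) * C (m j 2))
      + C (m i 2) ^ 3 * (C (c 9) * C (m j 0) + C (c 13) * C (m j 1) + C (c 14) * C (m j 2)) : MvPolynomial (Fin 3) k)
      = if i = j then 1 else 0 := by
      intro i j
      have := congrArg (C (σ := Fin 3)) (hm i j)
      rw [hS] at this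
      simp only [map_add, map_mul, map_pow] at this
      rw [this]
      split_ifs <;> simp
    have q3 : ∀ x y z : MvPolynomial (Fin 3) k, qf (fun i => C (c i)) x y z =
        x ^ 3 * (C (c 0) * x + C (c 1) * y + C (c 2) * z) + y ^ 3 * (C (c 6) * x + C (c 10) * y + C (c 11) * z)
        + z ^ 3 * (C (c 9) * x + C (c 13) * y + C (c 14) * z) := by
      intro x y z
      simp only [qf, c3, c4, c5, c7, c8, c12, C_0]; ring
    rw [substM, aeval_Qp]
    simp only [algebraMap_eq]
    rw [q3]
    simp only [Matrix.of_apply, Fin.sum_univ_three, ca, mul_pow]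
    have e00 := e 0 0
    have e01 := e 0 1
    have e02 := e 0 2
    have e10 := e 1 0
    have e11 := e 1 1
    have e12 := e 1 2
    have e20 := e 2 0
    have e21 := e 2 1
    have e22 := e 2 2
    simp at e00 e01 e02 e10 e11 e12 e20 e21 e22
    linear_combination X 0 ^ 3 * (X 0 * e00 + X 1 * e01 + X 2 * e02) + X 1 ^ 3 * (X 0 * e10 + X 1 * e11 + X 2 * e12)
      + X 2 ^ 3 * (X 0 * e20 + X 1 * e21 + X 2 * e22)

end

section
variable {k : Type*} [Field k]

lemma poly_three (h3 : (3 : k) = 0) {σ : Type*} : (3 : MvPolynomial σ k) = 0 := by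
  rw [show (3 : MvPolynomial σ k) = C 3 from (map_ofNat C 3).symm, h3, C_0]

lemma restrict_subst (M : Matrix (Fin 3) (Fin 3) k) (q : MvPolynomial (Fin 3) k) (P W : Fin 3 → k) :
    restrictLine q (M.mulVec P) (M.mulVec W) = restrictLine (substM M q) P W := by
  rw [restrictLine, restrictLine, substM, ← AlgHom.comp_apply, comp_aeval]
  congr 2
  funext i
  simp only [Matrix.mulVec, dotProduct, Fin.sum_univ_three, map_add, map_mul, aeval_X, algHom_C, algebraMap_eq]
  ring

lemma infl_smul (q : MvPolynomial (Fin 3) k) (d : Fin 3 → k) (a : k) (ha : a ≠ 0) (h : IsInflectionLine q d) :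
    IsInflectionLine q (a • d) := by
  obtain ⟨hd, x, y, hxy, hx, hy, hT⟩ := h
  refine ⟨smul_ne_zero ha hd, x, y, hxy, ?_, ?_, hT⟩
  · simp only [dot3, Pi.smul_apply, smul_eq_mul] at *; linear_combination a * hx
  · simp only [dot3, Pi.smul_apply, smul_eq_mul] at *; linear_combination a * hy

lemma infl_fermat (h3 : (3 : k) = 0) (q : MvPolynomial (Fin 3) k) (M : Matrix (Fin 3) (Fin 3) k) (hM : IsUnit M.det)
    (h : substM M q = X 0 ^ 4 + X 1 ^ 4 + X 2 ^ 4) (y z : k) (hz : z ≠ 0) (hy : y ^ 4 = -1 - z ^ 4) :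
    IsInflectionLine q (Matrix.vecMul ![1, y ^ 3, z ^ 3] M⁻¹) := by
  have hdot : ∀ u p : Fin 3 → k, dot3 (Matrix.vecMul u M⁻¹) (M.mulVec p) = dot3 u p := by
    intro u p
    have : ∀ u p : Fin 3 → k, dot3 u p = u ⬝ᵥ p := fun u p => by simp [dot3, dotProduct, Fin.sum_univ_three]
    rw [this, this, Matrix.dotProduct_mulVec, Matrix.vecMul_vecMul, Matrix.nonsing_inv_mul _ hM, Matrix.vecMul_one]
  refine ⟨?_, M.mulVec ![1, y, z], M.mulVec ![- y ^ 3, 1, 0], ?_, ?_, ?_, ?_⟩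
  · intro h0
    have := congrArg (fun v => Matrix.vecMul v M) h0
    simp only [Matrix.vecMul_vecMul, Matrix.nonsing_inv_mul _ hM, Matrix.vecMul_one, Matrix.zero_vecMul] at this
    simpa using congrFun this 0
  · rw [LinearIndependent.pair_iff]
    intro s t hst
    rw [← Matrix.mulVec_smul, ← Matrix.mulVec_smul, ← Matrix.mulVec_add] at hst
    have := congrArg (fun v => M⁻¹.mulVec v) hst
    simp only [Matrix.mulVec_mulVec, Matrix.nonsing_inv_mul _ hM, Matrix.one_mulVec, Matrix.mulVec_zero] at this
    have e2 := congrFun this 2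
    have e1 := congrFun this 1
    simp at e1 e2
    have hs : s = 0 := e2.resolve_right hz
    rw [hs] at e1
    exact ⟨hs, by simpa using e1⟩
  · rw [hdot]; simp [dot3]; linear_combination hy
  · rw [hdot]; simp [dot3]
  · rw [restrict_subst, h]
    refine ⟨X 1, C (- y ^ 9 + y) * X 0 + C (y ^ 12 + 1) * X 1, isHomogeneous_X _ _, ?_, X_ne_zero _, ?_⟩
    · have a : ∀ (n : k) i, (C n * X i : MvPolynomial (Fin 2) k).IsHomogeneous 1 := fun n i => by
        simpa using (isHomogeneous_C (Fin 2) n).mul (isHomogeneous_X k i)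
      exact (a _ _).add (a _ _)
    · have h3' := poly_three h3 (σ := Fin 2)
      have hy' : (C y ^ 4 : MvPolynomial (Fin 2) k) = -1 - C z ^ 4 := by
        rw [← C_pow, hy]; simp
      simp only [restrictLine, map_add, map_pow, aeval_X, map_neg, map_one]
      simp
      linear_combination X 0 ^ 4 * hy' + (X 0 * C y * X 1 ^ 3 - X 0 * C y ^ 9 * X 1 ^ 3 + X 0 ^ 2 * C y ^ 2 * X 1 ^ 2 * 2 +
        X 0 ^ 2 * C y ^ 6 * X 1 ^ 2 * 2) * h3'

variable [IsAlgClosed k]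

lemma infl_infinite (h3 : (3 : k) = 0) (q : MvPolynomial (Fin 3) k) (M : Matrix (Fin 3) (Fin 3) k) (hM : IsUnit M.det)
    (h : substM M q = X 0 ^ 4 + X 1 ^ 4 + X 2 ^ 4) :
    {ℓ : Projectivization k (Fin 3 → k) | IsInflectionLine q ℓ.rep}.Infinite := by
  choose y hy using fun z : k => IsAlgClosed.exists_pow_nat_eq (-1 - z ^ 4) (show 0 < 4 by norm_num)
  have hi : ∀ z : {z : k // z ≠ 0}, IsInflectionLine q (Matrix.vecMul ![1, y z ^ 3, z.1 ^ 3] M⁻¹) := fun z =>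
    infl_fermat h3 q M hM h (y z) z z.2 (hy z)
  haveI : Infinite k := IsAlgClosed.instInfinite
  haveI : Infinite {z : k // z ≠ 0} := (Set.finite_singleton (0 : k)).infinite_compl.to_subtype
  refine Set.infinite_of_injective_forall_mem (f := fun z : {z : k // z ≠ 0} =>
    Projectivization.mk k (Matrix.vecMul ![1, y z ^ 3, z.1 ^ 3] M⁻¹) (hi z).1) ?_ ?_
  · intro z z' hzz
    simp only at hzz
    rw [Projectivization.mk_eq_mk_iff'] at hzz
    obtain ⟨a, ha⟩ := hzz
    rw [← Matrix.smul_vecMul] at ha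
    have := congrArg (fun v => Matrix.vecMul v M) ha
    simp only [Matrix.vecMul_vecMul, Matrix.nonsing_inv_mul _ hM, Matrix.vecMul_one] at this
    have e0 := congrFun this 0
    have e2 := congrFun this 2
    simp at e0 e2
    rw [e0, one_mul] at e2
    have : (z'.1 - z.1) ^ 3 = 0 := by
      linear_combination e2 + (- z'.1 ^ 2 * z.1 + z'.1 * z.1 ^ 2) * h3
    have := pow_eq_zero_iff (by norm_num) |>.mp this
    exact Subtype.ext (sub_eq_zero.mp this).symm
  · intro z
    obtain ⟨a, ha⟩ := Projectivization.exists_smul_eq_mk_rep k _ (hi z).1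
    show IsInflectionLine q (Projectivization.rep _)
    rw [← ha]
    exact infl_smul q _ _ a.ne_zero (hi z)

lemma SG_fermat (h3 : (3 : k) = 0) (c : Fin 15 → k) (M : Matrix (Fin 3) (Fin 3) k) (hM : IsUnit M.det)
    (h : substM M (Qp c) = X 0 ^ 4 + X 1 ^ 4 + X 2 ^ 4) : SG (Qp c) = 0 := by
  have ev : ∀ p : Fin 3 → k, qf c (M.mulVec p 0) (M.mulVec p 1) (M.mulVec p 2) = p 0 ^ 4 + p 1 ^ 4 + p 2 ^ 4 := by
    intro p
    have := congrArg (eval p) h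
    rw [substM, aeval_Qp] at this
    simp only [algebraMap_eq] at this
    have e : ∀ f g h : MvPolynomial (Fin 3) k, eval p (qf (fun i => C (c i)) f g h)
      = qf c (eval p f) (eval p g) (eval p h) := eval_qf c p
    rw [e] at this
    simpa [Matrix.mulVec, dotProduct] using this
  have hW : ∀ a b : Fin 3 → k, Wf c (a 0) (a 1) (a 2) (b 0) (b 1) (b 2) = 0 := by
    intro a b
    obtain ⟨p, rfl⟩ : ∃ p, M.mulVec p = a := ⟨M⁻¹.mulVec a, by
      rw [Matrix.mulVec_mulVec, Matrix.mul_nonsing_inv _ hM, Matrix.one_mulVec]⟩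
    obtain ⟨r, rfl⟩ : ∃ p, M.mulVec p = b := ⟨M⁻¹.mulVec b, by
      rw [Matrix.mulVec_mulVec, Matrix.mul_nonsing_inv _ hM, Matrix.one_mulVec]⟩
    have key := quart_coeffs 
      (qf c (M.mulVec p 0) (M.mulVec p 1) (M.mulVec p 2) - (p 0 ^ 4 + p 1 ^ 4 + p 2 ^ 4))
      (gdot c (M.mulVec p 0) (M.mulVec p 1) (M.mulVec p 2) (M.mulVec r 0) (M.mulVec r 1) (M.mulVec r 2)
        - 4 * (p 0 ^ 3 * r 0 + p 1 ^ 3 * r 1 + p 2 ^ 3 * r 2))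
      (Wf c (M.mulVec p 0) (M.mulVec p 1) (M.mulVec p 2) (M.mulVec r 0) (M.mulVec r 1) (M.mulVec r 2)
        - 6 * (p 0 ^ 2 * r 0 ^ 2 + p 1 ^ 2 * r 1 ^ 2 + p 2 ^ 2 * r 2 ^ 2))
      (gdot c (M.mulVec r 0) (M.mulVec r 1) (M.mulVec r 2) (M.mulVec p 0) (M.mulVec p 1) (M.mulVec p 2)
        - 4 * (p 0 * r 0 ^ 3 + p 1 * r 1 ^ 3 + p 2 * r 2 ^ 3))
      (qf c (M.mulVec r 0) (M.mulVec r 1) (M.mulVec r 2) - (r 0 ^ 4 + r 1 ^ 4 + r 2 ^ 4)) (fun t => by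
        have e := ev (p + t • r)
        simp only [Matrix.mulVec_add, Matrix.mulVec_smul, Pi.add_apply, Pi.smul_apply, smul_eq_mul] at e
        have tt := taylor c (M.mulVec p 0) (M.mulVec p 1) (M.mulVec p 2) (M.mulVec r 0) (M.mulVec r 1) (M.mulVec r 2) 1 t
        simp only [one_mul] at tt
        rw [tt] at e
        linear_combination e)
    linear_combination key.2.2.1 + 2 * (p 0 ^ 2 * r 0 ^ 2 + p 1 ^ 2 * r 1 ^ 2 + p 2 ^ 2 * r 2 ^ 2) * h3
  obtain ⟨h0, h1, h2, h3', h4⟩ := binCoeff_expl _ _ _ _ _ _ (gsub_Qp c)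
  have hW' : Wf (cC c) (- X 1) (X 0) 0 (- X 2) 0 (X 0) = (0 : MvPolynomial (Fin 3) k) := by
    apply MvPolynomial.funext
    intro p
    have := hW ![- p 1, p 0, 0] ![- p 2, 0, p 0]
    simpa [Wf, eval_hXX, eval_hYY, eval_hZZ, eval_qXY, eval_qXZ, eval_qYZ] using this
  have p3 := poly_three h3 (σ := Fin 3)
  rw [SG, Sinv, h2, hW']
  linear_combination (4 * binCoeff (gsub (Qp c)) 0 * binCoeff (gsub (Qp c)) 4 - binCoeff (gsub (Qp c)) 1 * binCoeff (gsub (Qp c)) 3) * p3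

end

/-- For a smooth plane quartic `C = {q = 0}` over an algebraically closed
field, the following are equivalent: (1) `C` has infinitely many inflection lines;
(2) `q` is totally harmonic (`H(q) = 0`, i.e. `SG q = 0`); (3) the characteristic is `3`
and `C` is projectively equivalent to the Fermat quartic. -/
theorem stmt6 {k : Type*} [Field k] [IsAlgClosed k]
    (q : MvPolynomial (Fin 3) k) (hq0 : q ≠ 0) (hq4 : q.IsHomogeneous 4)
    (hsm : ∀ pt : Fin 3 → k, pt ≠ 0 → eval pt q = 0 → ∃ i, eval pt (pderiv i q) ≠ 0) :
    ({ℓ : Projectivization k (Fin 3 → k) | IsInflectionLine q ℓ.rep}.Infinite ↔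
        SG q = 0) ∧
    (SG q = 0 ↔ ringChar k = 3 ∧ ∃ M : Matrix (Fin 3) (Fin 3) k, IsUnit M.det ∧
        substM M q = X 0 ^ 4 + X 1 ^ 4 + X 2 ^ 4) := by
  obtain ⟨c, rfl⟩ := exists_coeffs q hq4
  have hc := good_of c hq0 hq4 hsm
  have h13 : Flex c → ringChar k = 3 ∧ ∃ M : Matrix (Fin 3) (Fin 3) k, IsUnit M.det ∧
        substM M (Qp c) = X 0 ^ 4 + X 1 ^ 4 + X 2 ^ 4 := fun hF => by
    have h3 := flex_three hc hF
    refine ⟨?_, fermat_of_six h3 hc (six_zero h3 hc hF)⟩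
    have hd : ringChar k ∣ 3 := ringChar.dvd (by exact_mod_cast h3)
    rcases (Nat.dvd_prime Nat.prime_three).mp hd with h | h
    · exact absurd h CharP.ringChar_ne_one
    · exact h
  have c3 : ringChar k = 3 → (3 : k) = 0 := fun h => by
    have := ringChar.Nat.cast_ringChar (R := k)
    rw [h] at this
    exact_mod_cast this
  refine ⟨⟨fun h => ?_, fun h => ?_⟩, ⟨fun h => h13 (flex_of_SG hc h), fun h => ?_⟩⟩
  · obtain ⟨hr, M, hM, hs⟩ := h13 (flex_of_infl hc h)
    exact SG_fermat (c3 hr) c M hM hs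
  · obtain ⟨hr, M, hM, hs⟩ := h13 (flex_of_SG hc h)
    exact infl_infinite (c3 hr) _ M hM hs
  · obtain ⟨hr, M, hM, hs⟩ := h
    exact SG_fermat (c3 hr) c M hM hs
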